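/- arXiv:1705.07493 — 3 statements merged into one kernel-verified Lean document; each statement's English description precedes it below -/
import Mathlib

section
/- Assume the connectivity assumption, let λ and c be T-periodic and locally piecewise constant, assume the stability condition, and assume there exists Δ > 0 such that T, every δ_{ji}, and every discontinuity point of λ and of c is an integer multiple of Δ. Then there exists a solution (x*, z*) of the traffic flow model (for some initial condition and piecewise constant initial history) that is T-periodic, i.e., x*(t+T) = x*(t) for all t ≥ 0 and z*(t+T) = z*(t) for all t ≥ −δ̄; any two T-periodic solutions agree for all t ≥ 0; and every solution (x, z) with piecewise constant initial history converges to it, in the sense that Σ_{i ∈ E} |x_i(t) − x*_i(t)| + Σ_{i ∈ E} Σ_{j ∈ E} R_{ji} ∫_{t−δ_{ji}}^{t} |z_j(s) − z*_j(s)| ds → 0 as t → ∞. -/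
open MeasureTheory

variable {E : Type*}

/-- `f` is piecewise constant on the set `s`: there is a finite set `D` of breakpoints
such that `f` is constant between consecutive breakpoints (pieces are right-open). -/
def PwcOn (f : ℝ → ℝ) (s : Set ℝ) : Prop :=
  ∃ D : Finset ℝ, ∀ u ∈ s, ∀ v ∈ s, u ≤ v → (∀ d ∈ D, d ∉ Set.Ioc u v) → f u = f v

/-- `f` is locally piecewise constant on `s`: piecewise constant on every compact
subinterval of `s`. -/
def LocPwcOn (f : ℝ → ℝ) (s : Set ℝ) : Prop :=
  ∀ a b : ℝ, PwcOn f (s ∩ Set.Icc a b)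

/-- The maximum `δ̄` of the inter-link travel times over pairs `(j, i)` with `R j i > 0`
(and `0` if there are no such pairs). -/
noncomputable def dbar (R δ : E → E → ℝ) : ℝ :=
  sSup (insert 0 {d : ℝ | ∃ j i, 0 < R j i ∧ δ j i = d})

/-- `w ∈ ℝ^E` is feasible at time `t` for the traffic flow model:
`w i ≤ c t i` for every link `i`, and for every link `i` with empty queue (`x t i = 0`),
`w i ≤ λ̃_i(t) + Σ_{j ∈ E_i} R j i * w j`, where `E_i = {j : R j i > 0 ∧ δ j i = 0}` and
`λ̃_i(t) = λ_i(t) + Σ_{j ∉ E_i} R j i * z (t - δ j i) j`. -/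
def FeasibleAt (R δ : E → E → ℝ) (lam c : ℝ → E → ℝ) (x z : ℝ → E → ℝ)
    (t : ℝ) (w : E → ℝ) [Fintype E] : Prop :=
  (∀ i, w i ≤ c t i) ∧
  ∀ i, x t i = 0 →
    w i ≤ lam t i + ∑ j, R j i * (if δ j i = 0 then w j else z (t - δ j i) j)

/-- `(x, z)` is a solution of the traffic flow model with routing matrix `R`, travel
times `δ`, external inflow `lam` and capacity `c`: queue lengths and outflows are
nonnegative, `z` is locally integrable on `[-δ̄, ∞)`, at every time `t ≥ 0` the outflow
`z t` is feasible and maximizes the cumulative outflow `Σ_i w i` among feasible vectors,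
and the queue lengths satisfy the integral mass-balance equation. -/
def IsSolution [Fintype E] (R δ : E → E → ℝ) (lam c : ℝ → E → ℝ)
    (x z : ℝ → E → ℝ) : Prop :=
  (∀ t, 0 ≤ t → ∀ i, 0 ≤ x t i) ∧
  (∀ t, -(dbar R δ) ≤ t → ∀ i, 0 ≤ z t i) ∧
  (∀ i, LocallyIntegrableOn (fun t => z t i) (Set.Ici (-(dbar R δ)))) ∧
  (∀ t, 0 ≤ t → FeasibleAt R δ lam c x z t (fun i => z t i)) ∧
  (∀ t, 0 ≤ t → ∀ w : E → ℝ, FeasibleAt R δ lam c x z t w → ∑ i, w i ≤ ∑ i, z t i) ∧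
  (∀ t, 0 ≤ t → ∀ i,
    x t i = x 0 i + ∫ s in (0:ℝ)..t, (lam s i + ∑ j, R j i * z (s - δ j i) j - z s i))

/-- Reachability in the directed graph on links with an edge from `j` to `i`
whenever `R j i > 0`. -/
def Reach (R : E → E → ℝ) : E → E → Prop :=
  Relation.TransGen fun a b => 0 < R a b

/-- Connectivity assumption: the graph is weakly connected, all row sums of `R` are at
most one, and from every link either its own row sum is less than one or a link with
row sum less than one is reachable. -/
def ConnAssumption [Fintype E] (R : E → E → ℝ) : Prop :=
  (∀ i j : E, i ≠ j → Reach R i j ∨ Reach R j i) ∧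
  (∀ i : E, ∑ l, R i l ≤ 1) ∧
  (∀ i : E, (∑ l, R i l < 1) ∨ ∃ j, Reach R i j ∧ ∑ l, R j l < 1)

/-- Stability condition: `c̄_i − Σ_j R j i * c̄_j > λ̄_i` for every link `i`, where bars
denote averages over one period `[0, T]`. -/
def Stability [Fintype E] (T : ℝ) (R : E → E → ℝ) (lam c : ℝ → E → ℝ) : Prop :=
  ∀ i : E, (1 / T) * ∫ s in (0:ℝ)..T, lam s i <
    (1 / T) * (∫ s in (0:ℝ)..T, c s i) -
      ∑ j, R j i * ((1 / T) * ∫ s in (0:ℝ)..T, c s j)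

section Network

variable {N : Type*} [Fintype N] {Q : N → N → ℝ} {p : N → ℝ} {S : Set N} {c a u v y : N → ℝ}

/-- A positive strictly superharmonic weight for a nonnegative routing matrix. -/
def IsWeight (Q : N → N → ℝ) (p : N → ℝ) : Prop :=
  (∀ i, 0 < p i) ∧ ∀ j, ∑ i, Q j i * p i < p j

theorem exists_superharmonic (hQ : ∀ j i, 0 ≤ Q j i) {j l : N} {q : N → ℝ} (hjl : 0 < Q j l)
    (hq : ∀ i, 0 ≤ q i) (hsup : ∀ k, ∑ i, Q k i * q i ≤ q k) (hl : ∑ i, Q l i * q i < q l) :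
    ∃ q' : N → ℝ, (∀ i, 0 ≤ q' i) ∧ (∀ k, ∑ i, Q k i * q' i ≤ q' k) ∧
      ∑ i, Q j i * q' i < q' j := by
  refine ⟨fun k => ∑ i, Q k i * q i, fun k => Finset.sum_nonneg fun i _ => mul_nonneg (hQ _ _) (hq i),
    fun k => Finset.sum_le_sum fun i _ => mul_le_mul_of_nonneg_left (hsup i) (hQ _ _), ?_⟩
  exact Finset.sum_lt_sum (fun i _ => mul_le_mul_of_nonneg_left (hsup i) (hQ _ _))
    ⟨l, Finset.mem_univ _, mul_lt_mul_of_pos_left hl hjl⟩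

theorem ConnAssumption.exists_isWeight {R : N → N → ℝ} (hR : ∀ j i, 0 ≤ R j i)
    (h : ConnAssumption R) : ∃ p, IsWeight R p := by
  obtain ⟨-, hrow, hex⟩ := h
  have deficient : ∀ j, ∑ l, R j l < 1 → ∃ q : N → ℝ, (∀ i, 0 ≤ q i) ∧
      (∀ k, ∑ i, R k i * q i ≤ q k) ∧ ∑ i, R j i * q i < q j := fun j hj =>
    ⟨fun _ => 1, fun _ => zero_le_one, by simpa using hrow, by simpa using hj⟩
  have key : ∀ j, ∃ q : N → ℝ, (∀ i, 0 ≤ q i) ∧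
      (∀ k, ∑ i, R k i * q i ≤ q k) ∧ ∑ i, R j i * q i < q j := by
    intro j
    rcases hex j with hj | ⟨k, hjk, hk⟩
    · exact deficient j hj
    · unfold Reach at hjk
      induction hjk using Relation.TransGen.head_induction_on with
      | single h1 =>
        obtain ⟨q, hq, hs, hl⟩ := deficient k hk
        exact exists_superharmonic hR h1 hq hs hl
      | head h1 _ ih =>
        obtain ⟨q, hq, hs, hl⟩ := ih
        exact exists_superharmonic hR h1 hq hs hl
  choose q hq hs hl using key
  have hlt : ∀ j, ∑ i, R j i * ∑ k, q k i < ∑ k, q k j := by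
    intro j
    simp only [Finset.mul_sum]
    rw [Finset.sum_comm]
    exact Finset.sum_lt_sum (fun k _ => hs k j) ⟨j, Finset.mem_univ _, hl j⟩
  refine ⟨fun i => ∑ k, q k i, fun i => lt_of_le_of_lt ?_ (hlt i), hlt⟩
  exact Finset.sum_nonneg fun l _ => mul_nonneg (hR _ _) (Finset.sum_nonneg fun k _ => hq k l)

theorem IsWeight.eq_zero (hp : IsWeight Q p) {d : N → ℝ} (hd : ∀ n, 0 ≤ d n)
    (h : ∀ n, d n ≤ ∑ l, Q l n * d l) : ∀ n, d n = 0 := by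
  have h1 : ∑ n, p n * d n ≤ ∑ l, (∑ n, Q l n * p n) * d l := by
    calc ∑ n, p n * d n ≤ ∑ n, p n * ∑ l, Q l n * d l :=
          Finset.sum_le_sum fun n _ => mul_le_mul_of_nonneg_left (h n) (hp.1 n).le
      _ = ∑ l, (∑ n, Q l n * p n) * d l := by
          simp only [Finset.mul_sum, Finset.sum_mul]
          rw [Finset.sum_comm]
          exact Finset.sum_congr rfl fun _ _ => Finset.sum_congr rfl fun _ _ => by ring
  intro n
  by_contra hn
  have hn' : 0 < d n := lt_of_le_of_ne (hd n) (Ne.symm hn)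
  have h2 : ∑ l, (∑ n, Q l n * p n) * d l < ∑ n, p n * d n :=
    Finset.sum_lt_sum (fun l _ => mul_le_mul_of_nonneg_right (hp.2 l).le (hd l))
      ⟨n, Finset.mem_univ _, mul_lt_mul_of_pos_right (hp.2 n) hn'⟩
  linarith

/-- Comparison principle between sub- and supersolutions of the outflow equations. -/
theorem IsWeight.comparison (hp : IsWeight Q p) (hQ : ∀ j i, 0 ≤ Q j i)
    (huc : ∀ n, u n ≤ c n) (hua : ∀ n ∈ S, u n ≤ a n + ∑ l, Q l n * u l)
    (hva : ∀ n ∈ S, min (c n) (a n + ∑ l, Q l n * v l) ≤ v n) (hvc : ∀ n ∉ S, c n ≤ v n) :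
    ∀ n, u n ≤ v n := by
  have := hp.eq_zero (d := fun n => max (u n - v n) 0) (fun n => le_max_right _ _) (by
    intro n
    refine max_le ?_ (Finset.sum_nonneg fun l _ => mul_nonneg (hQ _ _) (le_max_right _ _))
    have hle : ∑ l, Q l n * (u l - v l) ≤ ∑ l, Q l n * max (u l - v l) 0 :=
      Finset.sum_le_sum fun l _ => mul_le_mul_of_nonneg_left (le_max_left _ _) (hQ _ _)
    have hnn : 0 ≤ ∑ l, Q l n * max (u l - v l) 0 :=
      Finset.sum_nonneg fun l _ => mul_nonneg (hQ _ _) (le_max_right _ _)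
    simp only [mul_sub, Finset.sum_sub_distrib] at hle
    by_cases hn : n ∈ S
    · have h1 := hua n hn
      have h3 := huc n
      rcases min_le_iff.1 (hva n hn) with h2 | h2 <;> linarith
    · have h2 := hvc n hn
      have h3 := huc n
      linarith)
  intro n
  have h := this n
  have h' := le_max_left (u n - v n) 0
  linarith

/-- A monotone self-map of the box `[0, b]` has a fixed point. -/
theorem exists_fixed_of_monotone {ι : Type*} {b : ι → ℝ} (hb : ∀ i, 0 ≤ b i)
    (F : (ι → ℝ) → ι → ℝ) (hF : ∀ u v, u ≤ v → F u ≤ F v)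
    (hF0 : ∀ u, 0 ≤ u → u ≤ b → 0 ≤ F u) (hFb : ∀ u, 0 ≤ u → u ≤ b → F u ≤ b) :
    ∃ u, 0 ≤ u ∧ u ≤ b ∧ F u = u := by
  have : Fact ((0 : ι → ℝ) ≤ b) := ⟨hb⟩
  let G : Set.Icc (0 : ι → ℝ) b →o Set.Icc (0 : ι → ℝ) b :=
    ⟨fun u => ⟨F u.1, hF0 _ u.2.1 u.2.2, hFb _ u.2.1 u.2.2⟩, fun u v h => hF _ _ h⟩
  have h := G.map_lfp
  exact ⟨(OrderHom.lfp G).1, (OrderHom.lfp G).2.1, (OrderHom.lfp G).2.2, congrArg Subtype.val h⟩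

/-- `u` is the outflow vector of a network without travel times, with external inflow `a`,
capacity `c` and set of empty queues `S`. -/
def IsOutflow (Q : N → N → ℝ) (S : Set N) (c a u : N → ℝ) : Prop :=
  ∀ n, (n ∈ S → u n = min (c n) (a n + ∑ l, Q l n * u l)) ∧ (n ∉ S → u n = c n)

theorem IsOutflow.le_cap (h : IsOutflow Q S c a u) (n : N) : u n ≤ c n := by
  by_cases hn : n ∈ S
  · exact ((h n).1 hn).trans_le (min_le_left _ _)
  · exact ((h n).2 hn).le

theorem IsOutflow.le_of_sub (h : IsOutflow Q S c a u) (hp : IsWeight Q p) (hQ : ∀ j i, 0 ≤ Q j i)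
    (hvc : ∀ n, v n ≤ c n) (hva : ∀ n ∈ S, v n ≤ a n + ∑ l, Q l n * v l) (n : N) : v n ≤ u n :=
  hp.comparison hQ hvc hva (fun n hn => ((h n).1 hn).ge) (fun n hn => ((h n).2 hn).ge) n

theorem IsOutflow.le_of_super (h : IsOutflow Q S c a u) (hp : IsWeight Q p)
    (hQ : ∀ j i, 0 ≤ Q j i) (hva : ∀ n ∈ S, min (c n) (a n + ∑ l, Q l n * v l) ≤ v n)
    (hvc : ∀ n ∉ S, c n ≤ v n) (n : N) : u n ≤ v n :=
  hp.comparison hQ h.le_cap (fun n hn => ((h n).1 hn).trans_le (min_le_right _ _)) hva hvc n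

theorem IsOutflow.nonneg (h : IsOutflow Q S c a u) (hp : IsWeight Q p) (hQ : ∀ j i, 0 ≤ Q j i)
    (hc : ∀ n, 0 ≤ c n) (ha : ∀ n, 0 ≤ a n) (n : N) : 0 ≤ u n :=
  h.le_of_sub (v := fun _ => 0) hp hQ hc (by simpa using fun n _ => ha n) n

theorem exists_isOutflow (hQ : ∀ j i, 0 ≤ Q j i) (S : Set N) (hc : ∀ n, 0 ≤ c n)
    (ha : ∀ n, 0 ≤ a n) : ∃ u, IsOutflow Q S c a u := by
  classical
  obtain ⟨u, -, -, hu⟩ := exists_fixed_of_monotone hc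
    (fun u n => if n ∈ S then min (c n) (a n + ∑ l, Q l n * u l) else c n) (by
      intro u v huv n
      dsimp only
      split_ifs
      · exact min_le_min_left _ (add_le_add_right
          (Finset.sum_le_sum fun l _ => mul_le_mul_of_nonneg_left (huv l) (hQ _ _)) _)
      · exact le_rfl) (by
      intro u hu _ n
      dsimp only
      split_ifs
      · exact le_min (hc n) (add_nonneg (ha n)
          (Finset.sum_nonneg fun l _ => mul_nonneg (hQ _ _) (hu l)))
      · exact hc n) (by
      intro u _ _ n
      dsimp only
      split_ifs
      · exact min_le_left _ _
      · exact le_rfl)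
  refine ⟨u, fun n => ⟨fun hn => ?_, fun hn => ?_⟩⟩
  · conv_lhs => rw [← hu]
    simp [hn]
  · conv_lhs => rw [← hu]
    simp [hn]

/-- A fluid path of the network without travel times, with constant inflow `a`, constant
capacity `c` and initial queues `y`: `Z` is the cumulative outflow and `w` the outflow rate. -/
structure FluidPath (Q : N → N → ℝ) (c a y : N → ℝ) (Z w : ℝ → N → ℝ) : Prop where
  routing_nonneg : ∀ j i, 0 ≤ Q j i
  cap_nonneg : ∀ n, 0 ≤ c n
  inflow_nonneg : ∀ n, 0 ≤ a n
  init_nonneg : ∀ n, 0 ≤ y n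
  cum : ∀ t, 0 ≤ t → IsOutflow Q Set.univ (fun n => t * c n) (fun n => y n + t * a n) (Z t)
  rate : ∀ t, 0 ≤ t →
    IsOutflow Q {n | y n + t * a n + ∑ l, Q l n * Z t l - Z t n = 0} c a (w t)
  rate_neg : ∀ t, t ≤ 0 → w t = w 0

theorem exists_fluidPath (hQ : ∀ j i, 0 ≤ Q j i) (hc : ∀ n, 0 ≤ c n) (ha : ∀ n, 0 ≤ a n)
    (hy : ∀ n, 0 ≤ y n) : ∃ Z w, FluidPath Q c a y Z w := by
  have hZ : ∀ t : ℝ, ∃ Z, 0 ≤ t →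
      IsOutflow Q Set.univ (fun n => t * c n) (fun n => y n + t * a n) Z := by
    intro t
    by_cases ht : 0 ≤ t
    · obtain ⟨Z, hZ⟩ := exists_isOutflow (Q := Q) (c := fun n => t * c n)
        (a := fun n => y n + t * a n) hQ Set.univ (fun n => mul_nonneg ht (hc n))
        (fun n => add_nonneg (hy n) (mul_nonneg ht (ha n)))
      exact ⟨Z, fun _ => hZ⟩
    · exact ⟨0, fun h => absurd h ht⟩
  choose Z hZ using hZ
  choose w hw using fun t : ℝ => exists_isOutflow (Q := Q) hQ
    {n | y n + t * a n + ∑ l, Q l n * Z t l - Z t n = 0} hc ha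
  refine ⟨Z, fun t => w (max t 0), hQ, hc, ha, hy, hZ, fun t ht => ?_, fun t ht => ?_⟩
  · simpa [max_eq_left ht] using hw t
  · simp [max_eq_right ht]

namespace FluidPath

variable {Z w : ℝ → N → ℝ}

theorem cum_eq (h : FluidPath Q c a y Z w) {t : ℝ} (ht : 0 ≤ t) (n : N) :
    Z t n = min (t * c n) (y n + t * a n + ∑ l, Q l n * Z t l) :=
  (h.cum t ht n).1 (Set.mem_univ n)

theorem cum_nonneg (h : FluidPath Q c a y Z w) (hp : IsWeight Q p) {t : ℝ} (ht : 0 ≤ t) (n : N) :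
    0 ≤ Z t n :=
  (h.cum t ht).nonneg hp h.routing_nonneg (fun n => mul_nonneg ht (h.cap_nonneg n))
    (fun n => add_nonneg (h.init_nonneg n) (mul_nonneg ht (h.inflow_nonneg n))) n

theorem cum_zero (h : FluidPath Q c a y Z w) (hp : IsWeight Q p) (n : N) : Z 0 n = 0 := by
  refine le_antisymm ?_ (h.cum_nonneg hp le_rfl n)
  simpa using (h.cum 0 le_rfl).le_cap n

theorem queue_nonneg (h : FluidPath Q c a y Z w) {t : ℝ} (ht : 0 ≤ t) (n : N) :
    0 ≤ y n + t * a n + ∑ l, Q l n * Z t l - Z t n := by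
  have := (h.cum_eq ht n).trans_le (min_le_right _ _)
  linarith

theorem cum_eq_cap (h : FluidPath Q c a y Z w) {t : ℝ} (ht : 0 ≤ t) {n : N}
    (hn : y n + t * a n + ∑ l, Q l n * Z t l - Z t n ≠ 0) : Z t n = t * c n := by
  rcases min_choice (t * c n) (y n + t * a n + ∑ l, Q l n * Z t l) with h1 | h1
  · rw [h.cum_eq ht n, h1]
  · exact absurd (by rw [h.cum_eq ht n] at hn; linarith [h.cum_eq ht n]) hn

theorem rate_nonneg (h : FluidPath Q c a y Z w) (hp : IsWeight Q p) (t : ℝ) (n : N) :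
    0 ≤ w t n := by
  rcases le_total 0 t with ht | ht
  · exact (h.rate t ht).nonneg hp h.routing_nonneg h.cap_nonneg h.inflow_nonneg n
  · rw [h.rate_neg t ht]
    exact (h.rate 0 le_rfl).nonneg hp h.routing_nonneg h.cap_nonneg h.inflow_nonneg n

theorem rate_le_cap (h : FluidPath Q c a y Z w) (t : ℝ) (n : N) : w t n ≤ c n := by
  rcases le_total 0 t with ht | ht
  · exact (h.rate t ht).le_cap n
  · rw [h.rate_neg t ht]
    exact (h.rate 0 le_rfl).le_cap n

theorem scaled_cum_le (h : FluidPath Q c a y Z w) (hp : IsWeight Q p) {s t : ℝ} (hs : 0 ≤ s)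
    (hst : s < t) (n : N) : s / t * Z t n ≤ Z s n := by
  have ht : 0 < t := hs.trans_lt hst
  have h1 : s / t ≤ 1 := (div_le_one ht).2 hst.le
  have h0 : 0 ≤ s / t := div_nonneg hs ht.le
  have hst' : s / t * t = s := div_mul_cancel₀ s ht.ne'
  refine (h.cum s hs).le_of_sub (v := fun n => s / t * Z t n) hp h.routing_nonneg ?_ ?_ n
  · intro n
    have := mul_le_mul_of_nonneg_left ((h.cum t ht.le).le_cap n) h0
    simpa only [← mul_assoc, hst'] using this
  · intro n _
    have h2 := mul_le_mul_of_nonneg_left ((h.cum_eq ht.le n).trans_le (min_le_right _ _)) h0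
    have h3 : ∑ l, Q l n * (s / t * Z t l) = s / t * ∑ l, Q l n * Z t l := by
      rw [Finset.mul_sum]
      exact Finset.sum_congr rfl fun _ _ => by ring
    have h4 : s / t * y n ≤ y n := mul_le_of_le_one_left (h.init_nonneg n) h1
    have h5 : s / t * (t * a n) = s * a n := by rw [← mul_assoc, hst']
    simp only [h3]
    linarith

theorem cum_sub_le_cap (h : FluidPath Q c a y Z w) (hp : IsWeight Q p) {s t : ℝ} (hs : 0 ≤ s)
    (hst : s ≤ t) (n : N) : Z t n - Z s n ≤ (t - s) * c n := by
  rcases hst.eq_or_lt with rfl | hlt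
  · simp
  have ht : 0 < t := hs.trans_lt hlt
  have h1 := h.scaled_cum_le hp hs hlt n
  have h2 := mul_le_mul_of_nonneg_left ((h.cum t ht.le).le_cap n)
    (div_nonneg (sub_nonneg.2 hst) ht.le)
  have h3 : (t - s) / t * (t * c n) = (t - s) * c n := by field_simp
  have h4 : (t - s) / t * Z t n = Z t n - s / t * Z t n := by field_simp
  linarith

theorem cum_sub_le (h : FluidPath Q c a y Z w) (hp : IsWeight Q p) {s t : ℝ} (hs : 0 ≤ s)
    (hst : s ≤ t) (n : N) : Z t n - Z s n ≤ (t - s) * w s n := by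
  have hts : 0 ≤ t - s := sub_nonneg.2 hst
  refine hp.comparison (S := {n | y n + s * a n + ∑ l, Q l n * Z s l - Z s n = 0})
    (u := fun n => Z t n - Z s n) (v := fun n => (t - s) * w s n) (c := fun n => (t - s) * c n)
    (a := fun n => (t - s) * a n) h.routing_nonneg (h.cum_sub_le_cap hp hs hst) ?_ ?_ ?_ n
  · intro n hn
    have h1 := (h.cum_eq (hs.trans hst) n).trans_le (min_le_right _ _)
    have hn : y n + s * a n + ∑ l, Q l n * Z s l - Z s n = 0 := hn
    simp only [mul_sub, Finset.sum_sub_distrib]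
    linarith
  · intro n hn
    have h1 := ((h.rate s hs) n).1 hn
    conv_rhs => rw [h1, mul_min_of_nonneg _ _ hts]
    refine le_of_eq ?_
    congr 1
    rw [mul_add, Finset.mul_sum]
    congr 1
    exact Finset.sum_congr rfl fun _ _ => by ring
  · intro n hn
    exact mul_le_mul_of_nonneg_left (((h.rate s hs) n).2 hn).ge hts

theorem le_cum_sub (h : FluidPath Q c a y Z w) (hp : IsWeight Q p) {s t : ℝ} (hs : 0 ≤ s)
    (hst : s ≤ t) (n : N) : (t - s) * w t n ≤ Z t n - Z s n := by
  have hts : 0 ≤ t - s := sub_nonneg.2 hst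
  have ht := hs.trans hst
  refine hp.comparison (S := {n | y n + t * a n + ∑ l, Q l n * Z t l - Z t n = 0})
    (v := fun n => Z t n - Z s n) (u := fun n => (t - s) * w t n) (c := fun n => (t - s) * c n)
    (a := fun n => (t - s) * a n) h.routing_nonneg
    (fun n => mul_le_mul_of_nonneg_left (h.rate_le_cap t n) hts) ?_ ?_ ?_ n
  · intro n hn
    have h1 := mul_le_mul_of_nonneg_left
      ((((h.rate t ht) n).1 hn).trans_le (min_le_right _ _)) hts
    rw [mul_add, Finset.mul_sum] at h1
    refine h1.trans_eq ?_
    congr 1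
    exact Finset.sum_congr rfl fun _ _ => by ring
  · intro n hn
    refine (min_le_right _ _).trans ?_
    have h1 := (h.cum_eq hs n).trans_le (min_le_right _ _)
    have hn : y n + t * a n + ∑ l, Q l n * Z t l - Z t n = 0 := hn
    simp only [mul_sub, Finset.sum_sub_distrib]
    linarith
  · intro n hn
    have h1 := h.cum_eq_cap ht hn
    have h2 := (h.cum s hs).le_cap n
    linarith

theorem rate_antitone (h : FluidPath Q c a y Z w) (hp : IsWeight Q p) (n : N) :
    Antitone fun t => w t n := by
  have key : ∀ s t, 0 ≤ s → s ≤ t → w t n ≤ w s n := by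
    intro s t hs hst
    rcases hst.eq_or_lt with rfl | hlt
    · exact le_rfl
    · exact le_of_mul_le_mul_left ((h.le_cum_sub hp hs hst n).trans (h.cum_sub_le hp hs hst n))
        (sub_pos.2 hlt)
  intro s t hst
  dsimp only
  rcases le_total 0 s with hs | hs
  · exact key s t hs hst
  · rw [h.rate_neg s hs]
    rcases le_total 0 t with ht | ht
    · exact key 0 t le_rfl ht
    · rw [h.rate_neg t ht]

theorem cum_continuousOn (h : FluidPath Q c a y Z w) (hp : IsWeight Q p) (n : N) :
    ContinuousOn (fun t => Z t n) (Set.Ici 0) := by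
  have key : ∀ s ∈ Set.Ici (0:ℝ), ∀ t ∈ Set.Ici (0:ℝ), s ≤ t →
      dist (Z s n) (Z t n) ≤ (c n).toNNReal * dist s t := by
    intro s hs t ht hst
    have h1 := h.cum_sub_le_cap hp hs hst n
    have h2 := h.le_cum_sub hp hs hst n
    have h3 := mul_nonneg (sub_nonneg.2 hst) (h.rate_nonneg hp t n)
    rw [dist_comm, dist_comm s t, Real.dist_eq, Real.dist_eq, abs_of_nonneg (h3.trans h2),
      abs_of_nonneg (sub_nonneg.2 hst), Real.coe_toNNReal _ (h.cap_nonneg n)]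
    linarith
  have : LipschitzOnWith (c n).toNNReal (fun t => Z t n) (Set.Ici 0) := by
    refine LipschitzOnWith.of_dist_le_mul fun s hs t ht => ?_
    rcases le_total s t with hst | hst
    · exact key s hs t ht hst
    · rw [dist_comm, dist_comm s t]
      exact key t ht s hs hst
  exact this.continuousOn

theorem queue_continuousOn (h : FluidPath Q c a y Z w) (hp : IsWeight Q p) (n : N) :
    ContinuousOn (fun t => y n + t * a n + ∑ l, Q l n * Z t l - Z t n) (Set.Ici 0) := by
  refine ContinuousOn.sub (ContinuousOn.add (by fun_prop) ?_) (h.cum_continuousOn hp n)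
  exact continuousOn_finsetSum _ fun l _ => (h.cum_continuousOn hp l).const_mul _

open Filter Topology in
theorem rate_eventually_eq (h : FluidPath Q c a y Z w) (hp : IsWeight Q p) {t : ℝ} (ht : 0 ≤ t) :
    ∀ᶠ s in 𝓝[≥] t, ∀ n, w s n = w t n := by
  have h1 : ∀ᶠ s in 𝓝[≥] t, ∀ n, y n + t * a n + ∑ l, Q l n * Z t l - Z t n ≠ 0 →
      y n + s * a n + ∑ l, Q l n * Z s l - Z s n ≠ 0 := by
    refine eventually_all.2 fun n => ?_
    by_cases hn : y n + t * a n + ∑ l, Q l n * Z t l - Z t n = 0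
    · exact Eventually.of_forall fun s hs => absurd hn hs
    · have hc := (h.queue_continuousOn hp n t ht).mono (Set.Ici_subset_Ici.2 ht)
      exact (hc.eventually_ne hn).mono fun s hs _ => hs
  filter_upwards [h1, self_mem_nhdsWithin] with s hs hts n
  have hs0 : 0 ≤ s := ht.trans hts
  refine le_antisymm (h.rate_antitone hp n hts) ?_
  refine (h.rate t ht).le_of_super hp h.routing_nonneg (v := w s) ?_ ?_ n
  · intro n _
    by_cases hn : y n + s * a n + ∑ l, Q l n * Z s l - Z s n = 0
    · exact ((h.rate s hs0 n).1 hn).ge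
    · exact (min_le_left _ _).trans ((h.rate s hs0 n).2 hn).ge
  · intro n hn
    exact ((h.rate s hs0 n).2 (hs n hn)).ge

open Filter Topology in
theorem integral_rate (h : FluidPath Q c a y Z w) (hp : IsWeight Q p) {t : ℝ} (ht : 0 ≤ t)
    (n : N) : ∫ s in (0:ℝ)..t, w s n = Z t n := by
  rw [intervalIntegral.integral_eq_sub_of_hasDeriv_right_of_le (f := fun s => Z s n) ht
    ((h.cum_continuousOn hp n).mono Set.Icc_subset_Ici_self) ?_
    (h.rate_antitone hp n).intervalIntegrable, h.cum_zero hp, sub_zero]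
  intro s hs
  have h1 : HasDerivWithinAt (fun r => Z s n + (r - s) * w s n) (w s n) (Set.Ioi s) s := by
    have := ((((hasDerivAt_id s).sub_const s).mul_const (w s n)).const_add (Z s n))
    simpa using this.hasDerivWithinAt
  refine h1.congr_of_eventuallyEq ?_ (by simp)
  have h2 := (h.rate_eventually_eq hp hs.1.le).filter_mono
    (nhdsWithin_mono s Set.Ioi_subset_Ici_self)
  filter_upwards [h2, self_mem_nhdsWithin] with r hr hsr
  have hsr : s < r := hsr
  have h3 := h.cum_sub_le hp hs.1.le hsr.le n
  have h4 := h.le_cum_sub hp hs.1.le hsr.le n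
  rw [hr n] at h4
  linarith

theorem rate_finite_range (h : FluidPath Q c a y Z w) (hp : IsWeight Q p) (n : N) :
    (Set.range fun t => w t n).Finite := by
  classical
  choose f hf using fun S : Set N => exists_isOutflow (Q := Q) h.routing_nonneg S
    h.cap_nonneg h.inflow_nonneg
  refine (Set.finite_range fun S : Set N => f S n).subset ?_
  have key : ∀ t, 0 ≤ t → w t n ∈ Set.range fun S : Set N => f S n := fun t ht =>
    ⟨_, le_antisymm
      ((h.rate t ht).le_of_sub hp h.routing_nonneg (hf _).le_cap
        (fun m hm => ((hf _ m).1 hm).trans_le (min_le_right _ _)) n)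
      ((hf _).le_of_sub hp h.routing_nonneg (h.rate t ht).le_cap
        (fun m hm => ((h.rate t ht m).1 hm).trans_le (min_le_right _ _)) n)⟩
  rintro _ ⟨t, rfl⟩
  rcases le_total 0 t with ht | ht
  · exact key t ht
  · dsimp only
    rw [h.rate_neg t ht]
    exact key 0 le_rfl

theorem exists_breakpoints (h : FluidPath Q c a y Z w) (hp : IsWeight Q p) (n : N) :
    ∃ D : Finset ℝ, ∀ u v, 0 ≤ u → u ≤ v → (∀ d ∈ D, d ∉ Set.Ioc u v) → w u n = w v n := by
  let L : ℝ → Set ℝ := fun r => {t | 0 ≤ t ∧ w t n = r}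
  refine ⟨((h.rate_finite_range hp n).image fun r => sInf (L r)).toFinset, ?_⟩
  intro u v hu huv hD
  by_contra hne
  have hv : v ∈ L (w v n) := ⟨hu.trans huv, rfl⟩
  have hbdd : BddBelow (L (w v n)) := ⟨0, fun t ht => ht.1⟩
  have hlow : ∀ t ∈ L (w v n), u ≤ t := by
    intro t ht
    by_contra! htu
    exact hne (le_antisymm (ht.2 ▸ h.rate_antitone hp n htu.le) (h.rate_antitone hp n huv))
  have hd0 : u ≤ sInf (L (w v n)) := le_csInf ⟨v, hv⟩ hlow
  have hattain : w (sInf (L (w v n))) n = w v n := by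
    have hev := h.rate_eventually_eq hp (hu.trans hd0)
    obtain ⟨r, hr, hsub⟩ := mem_nhdsGE_iff_exists_Ico_subset.1 hev
    obtain ⟨t, htL, htr⟩ := exists_lt_of_csInf_lt ⟨v, hv⟩ hr
    rw [← hsub ⟨csInf_le hbdd htL, htr⟩ n]
    exact htL.2
  refine hD (sInf (L (w v n))) ?_ ⟨lt_of_le_of_ne hd0 ?_, csInf_le hbdd hv⟩
  · rw [Set.Finite.mem_toFinset]
    exact ⟨w v n, ⟨v, rfl⟩, rfl⟩
  · intro heq
    exact hne (heq ▸ hattain)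

end FluidPath

end Network

section LocalEquations

variable [Fintype E] {R δ : E → E → ℝ} {lam c x z : ℝ → E → ℝ} {p : E → ℝ} {t : ℝ}

/-- The local outflow equations at time `t`: a link with a queue discharges at capacity, a link
without a queue at the minimum of its capacity and its total inflow. -/
def LocalEq (R δ : E → E → ℝ) (lam c x z : ℝ → E → ℝ) (t : ℝ) : Prop :=
  ∀ i, (x t i = 0 → z t i = min (c t i) (lam t i + ∑ j, R j i * z (t - δ j i) j)) ∧
    (x t i ≠ 0 → z t i = c t i)

theorem sum_instant_eq (i : E) :
    ∑ j, R j i * (if δ j i = 0 then z t j else z (t - δ j i) j) =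
      ∑ j, R j i * z (t - δ j i) j := by
  refine Finset.sum_congr rfl fun j _ => ?_
  split_ifs with h
  · rw [h, sub_zero]
  · rfl

theorem localEq_of_maximal (hR : ∀ j i, 0 ≤ R j i)
    (hf : FeasibleAt R δ lam c x z t fun i => z t i)
    (hm : ∀ w : E → ℝ, FeasibleAt R δ lam c x z t w → ∑ i, w i ≤ ∑ i, z t i) :
    LocalEq R δ lam c x z t := by
  classical
  have hle : ∀ i, x t i = 0 → z t i ≤ lam t i + ∑ j, R j i * z (t - δ j i) j := by
    intro i hi
    rw [← sum_instant_eq]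
    exact hf.2 i hi
  have key : ∀ i b, b ≤ c t i →
      (x t i = 0 → b ≤ lam t i + ∑ j, R j i * z (t - δ j i) j) → b ≤ z t i := by
    intro i b hbc hba
    by_contra! hlt
    have hup : ∀ j, z t j ≤ Function.update (z t) i b j := by
      intro j
      by_cases hj : j = i
      · subst hj
        simpa using hlt.le
      · simp [hj]
    have hfeas : FeasibleAt R δ lam c x z t (Function.update (z t) i b) := by
      constructor
      · intro j
        by_cases hj : j = i
        · subst hj
          simpa using hbc
        · simpa [hj] using hf.1 j
      · intro j hxj
        have hmono : ∑ k, R k j * z (t - δ k j) k ≤ ∑ k, R k j *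
            (if δ k j = 0 then Function.update (z t) i b k else z (t - δ k j) k) := by
          rw [← sum_instant_eq]
          refine Finset.sum_le_sum fun k _ => mul_le_mul_of_nonneg_left ?_ (hR k j)
          split_ifs
          · exact hup k
          · exact le_rfl
        refine le_trans ?_ (add_le_add_right hmono _)
        by_cases hj : j = i
        · subst hj
          simpa using hba hxj
        · simpa [hj] using hle j hxj
    have h1 := hm _ hfeas
    have h2 : ∑ j, z t j < ∑ j, Function.update (z t) i b j :=
      Finset.sum_lt_sum (fun j _ => hup j) ⟨i, Finset.mem_univ _, by simpa using hlt⟩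
    linarith
  intro i
  constructor
  · intro hi
    exact le_antisymm (le_min (hf.1 i) (hle i hi))
      (key i _ (min_le_left _ _) fun _ => min_le_right _ _)
  · intro hi
    exact le_antisymm (hf.1 i) (key i _ le_rfl fun h => absurd h hi)

theorem LocalEq.feasibleAt (h : LocalEq R δ lam c x z t) :
    FeasibleAt R δ lam c x z t fun i => z t i := by
  constructor
  · intro i
    by_cases hi : x t i = 0
    · exact ((h i).1 hi).trans_le (min_le_left _ _)
    · exact ((h i).2 hi).le
  · intro i hi
    dsimp only
    rw [sum_instant_eq]
    exact ((h i).1 hi).trans_le (min_le_right _ _)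

theorem LocalEq.maximal (h : LocalEq R δ lam c x z t) (hR : ∀ j i, 0 ≤ R j i)
    (hp : IsWeight R p) {w : E → ℝ} (hw : FeasibleAt R δ lam c x z t w) :
    ∑ i, w i ≤ ∑ i, z t i := by
  classical
  let Q : E → E → ℝ := fun j i => if δ j i = 0 then R j i else 0
  let a : E → ℝ := fun i => lam t i + ∑ j, if δ j i = 0 then 0 else R j i * z (t - δ j i) j
  have hQ : ∀ j i, 0 ≤ Q j i := fun j i => by
    dsimp only [Q]
    split_ifs
    exacts [hR j i, le_rfl]
  have hpQ : IsWeight Q p := by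
    refine ⟨hp.1, fun j => lt_of_le_of_lt (Finset.sum_le_sum fun i _ => ?_) (hp.2 j)⟩
    refine mul_le_mul_of_nonneg_right ?_ (hp.1 i).le
    dsimp only [Q]
    split_ifs
    exacts [le_rfl, hR j i]
  have hsplit : ∀ (v : E → ℝ) i, lam t i + ∑ j, R j i *
      (if δ j i = 0 then v j else z (t - δ j i) j) = a i + ∑ j, Q j i * v j := by
    intro v i
    simp only [a, Q, add_assoc, ← Finset.sum_add_distrib]
    congr 1
    refine Finset.sum_congr rfl fun j _ => ?_
    split_ifs <;> simp
  refine Finset.sum_le_sum fun i _ => hpQ.comparison (S := {i | x t i = 0}) (a := a) hQ hw.1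
    (fun i hi => ?_) (fun i hi => ?_) (fun i hi => ((h i).2 hi).ge) i
  · rw [← hsplit]
    exact hw.2 i hi
  · rw [← hsplit, sum_instant_eq]
    exact ((h i).1 hi).ge

end LocalEquations

section Cells

variable [Fintype E] {R : E → E → ℝ} {p : E → ℝ} {K : ℕ} [NeZero K] {m : E → E → ℕ} {Δ : ℝ}
  {L C : ZMod K → E → ℝ}

theorem ZMod.sum_univ_eq_sum_range (b : ZMod K → ℝ) :
    ∑ k, b k = ∑ l ∈ Finset.range K, b (l : ZMod K) := by
  refine Finset.sum_bij' (fun k _ => k.val) (fun l _ => (l : ZMod K)) ?_ ?_ ?_ ?_ ?_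
  · exact fun k _ => Finset.mem_range.2 (ZMod.val_lt k)
  · exact fun l _ => Finset.mem_univ _
  · exact fun k _ => ZMod.natCast_zmod_val k
  · exact fun l hl => ZMod.val_cast_of_lt (Finset.mem_range.1 hl)
  · exact fun k _ => by rw [ZMod.natCast_zmod_val]

theorem exists_cyclic_bound (b : ZMod K → ℝ) (hb : ∑ k, b k ≤ 0) :
    ∃ B : ZMod K → ℝ, (∀ k, 0 ≤ B k) ∧ ∀ k, B k + b k ≤ B (k + 1) := by
  refine ⟨fun k => ∑ l ∈ Finset.range K, |b (l : ZMod K)| +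
    ∑ l ∈ Finset.range k.val, b (l : ZMod K), fun k => ?_, fun k => ?_⟩
  · have h1 : -∑ l ∈ Finset.range k.val, b (l : ZMod K) ≤
        ∑ l ∈ Finset.range K, |b (l : ZMod K)| := by
      rw [← Finset.sum_neg_distrib]
      refine (Finset.sum_le_sum fun l _ => neg_le_abs _).trans ?_
      exact Finset.sum_le_sum_of_subset_of_nonneg
        (Finset.range_subset_range.2 (ZMod.val_lt k).le) fun _ _ _ => abs_nonneg _
    linarith
  · have hsucc : ∑ l ∈ Finset.range k.val, b (l : ZMod K) + b k =
        ∑ l ∈ Finset.range (k.val + 1), b (l : ZMod K) := by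
      rw [Finset.sum_range_succ, ZMod.natCast_zmod_val]
    rw [add_assoc, hsucc]
    rcases (Nat.succ_le_of_lt (ZMod.val_lt k)).lt_or_eq with hk | hk
    · have hK : 1 < K := by omega
      have : (k + 1).val = k.val + 1 := by
        have h1 : (1 : ZMod K).val = 1 := by
          have := ZMod.val_cast_of_lt hK
          simpa using this
        rw [ZMod.val_add_of_lt (by rw [h1]; exact hk), h1]
      simp only [this, le_refl]
    · have hk' : k.val + 1 = K := hk
      have h0 : k + 1 = 0 := by
        rw [← ZMod.natCast_zmod_val k, ← Nat.cast_add_one, hk', ZMod.natCast_self]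
      rw [hk', ← ZMod.sum_univ_eq_sum_range, h0]
      simpa using hb

/-- The routing matrix of the network unfolded over the `K` cells of a period: travel times
become shifts of the cell index, so the unfolded network has no travel times. -/
def unrolled (R : E → E → ℝ) (m : E → E → ℕ) (u v : ZMod K × E) : ℝ :=
  if u.1 = v.1 - (m u.2 v.2 : ZMod K) then R u.2 v.2 else 0

omit [Fintype E] [NeZero K] in
theorem unrolled_nonneg (hR : ∀ j i, 0 ≤ R j i) (u v : ZMod K × E) : 0 ≤ unrolled R m u v := by
  unfold unrolled
  split_ifs
  exacts [hR _ _, le_rfl]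

theorem sum_unrolled (f : ZMod K × E → ℝ) (k : ZMod K) (i : E) :
    ∑ u, unrolled R m u (k, i) * f u = ∑ j, R j i * f (k - (m j i : ZMod K), j) := by
  rw [Fintype.sum_prod_type_right]
  refine Finset.sum_congr rfl fun j _ => ?_
  simp [unrolled]

theorem IsWeight.unrolled (hp : IsWeight R p) :
    IsWeight (unrolled (K := K) R m) fun u => p u.2 := by
  refine ⟨fun u => hp.1 _, fun u => lt_of_eq_of_lt ?_ (hp.2 u.2)⟩
  rw [Fintype.sum_prod_type_right]
  refine Finset.sum_congr rfl fun i _ => ?_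
  have : ∀ k : ZMod K, (u.1 = k - (m u.2 i : ZMod K)) ↔ k = u.1 + (m u.2 i : ZMod K) := fun k =>
    ⟨fun h => by rw [h]; ring, fun h => by rw [h]; ring⟩
  simp [_root_.unrolled, this]

theorem exists_periodic_init (hR : ∀ j i, 0 ≤ R j i) (hp : IsWeight R p) (hΔ : 0 < Δ)
    (hL : ∀ k i, 0 ≤ L k i) (hC : ∀ k i, 0 ≤ C k i)
    (hstab : ∀ i, ∑ k, (L k i + ∑ j, R j i * C k j - C k i) < 0) :
    ∃ y : ZMod K × E → ℝ, (∀ u, 0 ≤ y u) ∧ ∀ Z w,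
      FluidPath (unrolled R m) (fun u => C u.1 u.2) (fun u => L u.1 u.2) y Z w →
      ∀ k i, y (k, i) + Δ * L k i + ∑ u, unrolled R m u (k, i) * Z Δ u - Z Δ (k, i) =
        y (k + 1, i) := by
  have hbound : ∀ i, ∃ B : ZMod K → ℝ, (∀ k, 0 ≤ B k) ∧ ∀ k, B k +
      Δ * (L k i + ∑ j, R j i * C (k - (m j i : ZMod K)) j - C k i) ≤ B (k + 1) := by
    intro i
    refine exists_cyclic_bound _ ?_
    rw [← Finset.mul_sum]
    refine mul_nonpos_of_nonneg_of_nonpos hΔ.le (le_trans (le_of_eq ?_) (hstab i).le)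
    simp only [Finset.sum_sub_distrib, Finset.sum_add_distrib]
    congr 2
    rw [Finset.sum_comm]
    conv_rhs => rw [Finset.sum_comm]
    refine Finset.sum_congr rfl fun j _ => ?_
    rw [← Finset.mul_sum, ← Finset.mul_sum]
    congr 1
    exact Equiv.sum_comp (Equiv.subRight (m j i : ZMod K)) fun k => C k j
  choose B hB0 hB using hbound
  let Q : ZMod K × E → ZMod K × E → ℝ := unrolled R m
  have hQ : ∀ u v, 0 ≤ Q u v := unrolled_nonneg hR
  let F : (ZMod K × E ⊕ ZMod K × E → ℝ) → ZMod K × E ⊕ ZMod K × E → ℝ := fun v =>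
    Sum.elim
      (fun n => max 0 (v (.inl (n.1 - 1, n.2)) + Δ * L (n.1 - 1) n.2 +
        ∑ u, Q u (n.1 - 1, n.2) * v (.inr u) - Δ * C (n.1 - 1) n.2))
      (fun n => min (Δ * C n.1 n.2) (v (.inl n) + Δ * L n.1 n.2 + ∑ u, Q u n * v (.inr u)))
  have hsum : ∀ (v v' : ZMod K × E ⊕ ZMod K × E → ℝ), v ≤ v' → ∀ n,
      ∑ u, Q u n * v (.inr u) ≤ ∑ u, Q u n * v' (.inr u) := fun v v' h n =>
    Finset.sum_le_sum fun u _ => mul_le_mul_of_nonneg_left (h _) (hQ _ _)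
  obtain ⟨v, hv0, -, hv⟩ := exists_fixed_of_monotone
    (b := Sum.elim (fun n : ZMod K × E => B n.2 n.1) fun n : ZMod K × E => Δ * C n.1 n.2)
    (by
      rintro (n | n)
      · exact hB0 _ _
      · exact mul_nonneg hΔ.le (hC _ _))
    F
    (by
      rintro v v' h (n | n)
      · have h1 := h (.inl (n.1 - 1, n.2))
        have h2 := hsum v v' h (n.1 - 1, n.2)
        exact max_le_max_left _ (by linarith)
      · have h1 := h (.inl n)
        have h2 := hsum v v' h n
        exact min_le_min_left _ (by linarith))
    (by
      rintro v h0 - (n | n)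
      · exact le_max_left _ _
      · refine le_min (mul_nonneg hΔ.le (hC _ _)) (add_nonneg (add_nonneg (h0 _)
          (mul_nonneg hΔ.le (hL _ _))) (Finset.sum_nonneg fun u _ => mul_nonneg (hQ _ _) (h0 _))))
    (by
      rintro v - hb (n | n)
      · refine max_le (hB0 _ _) ?_
        have h1 : v (.inl (n.1 - 1, n.2)) ≤ B n.2 (n.1 - 1) := hb _
        have h2 := hB n.2 (n.1 - 1)
        have h3 : ∑ u, Q u (n.1 - 1, n.2) * v (.inr u) ≤
            Δ * ∑ j, R j n.2 * C (n.1 - 1 - (m j n.2 : ZMod K)) j := by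
          refine (sum_unrolled (fun u => v (.inr u)) _ _).trans_le ?_
          rw [Finset.mul_sum]
          refine Finset.sum_le_sum fun j _ => ?_
          have := mul_le_mul_of_nonneg_left (hb (.inr (n.1 - 1 - (m j n.2 : ZMod K), j)))
            (hR j n.2)
          simp only [Sum.elim_inr] at this
          linarith
        rw [sub_add_cancel] at h2
        simp only [Sum.elim_inl]
        linarith
      · exact min_le_left _ _)
  refine ⟨fun u => v (.inl u), fun u => hv0 _, fun Z w hZ k i => ?_⟩
  have hv2 : ∀ n, v (.inr n) = min (Δ * C n.1 n.2)
      (v (.inl n) + Δ * L n.1 n.2 + ∑ u, Q u n * v (.inr u)) := fun n =>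
    (congrFun hv (.inr n)).symm
  have hZv : ∀ n, Z Δ n = v (.inr n) := by
    intro n
    refine le_antisymm ?_ ?_
    · exact (hZ.cum Δ hΔ.le).le_of_super (v := fun n => v (.inr n)) hp.unrolled (unrolled_nonneg hR)
        (fun n _ => (hv2 n).ge) (fun n hn => absurd (Set.mem_univ n) hn) n
    · exact (hZ.cum Δ hΔ.le).le_of_sub (v := fun n => v (.inr n)) hp.unrolled (unrolled_nonneg hR)
        (fun n => (hv2 n).trans_le (min_le_left _ _))
        (fun n _ => (hv2 n).trans_le (min_le_right _ _)) n
  have h1 : v (.inl (k + 1, i)) = max 0 (v (.inl (k, i)) + Δ * L k i +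
      ∑ u, Q u (k, i) * v (.inr u) - Δ * C k i) := by
    have := (congrFun hv (.inl (k + 1, i))).symm
    simpa [F] using this
  simp only [hZv, h1]
  have h2 := hv2 (k, i)
  simp only at h2
  rw [h2]
  change _ + ∑ u, Q u (k, i) * v (.inr u) - _ = _
  rcases le_total (Δ * C k i) (v (.inl (k, i)) + Δ * L k i + ∑ u, Q u (k, i) * v (.inr u))
    with h | h
  · rw [min_eq_left h, max_eq_right (by linarith)]
  · rw [min_eq_right h, max_eq_left (by linarith)]
    ring

end Cells

section Assembly

/-- The index of the cell of length `Δ` containing `t`. -/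
noncomputable def cell (Δ t : ℝ) : ℤ := ⌊t / Δ⌋

/-- The position of `t` in its cell of length `Δ`. -/
noncomputable def phase (Δ t : ℝ) : ℝ := t - cell Δ t * Δ

variable {Δ : ℝ}

theorem phase_nonneg (hΔ : 0 < Δ) (t : ℝ) : 0 ≤ phase Δ t := by
  have := (le_div_iff₀ hΔ).1 (Int.floor_le (t / Δ))
  unfold phase cell
  linarith

theorem phase_lt (hΔ : 0 < Δ) (t : ℝ) : phase Δ t < Δ := by
  have := (div_lt_iff₀ hΔ).1 (Int.lt_floor_add_one (t / Δ))
  unfold phase cell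
  linarith

theorem cell_add_phase (t : ℝ) : cell Δ t * Δ + phase Δ t = t := by
  unfold phase
  ring

theorem cell_eq (hΔ : 0 < Δ) (n : ℤ) {s : ℝ} (h0 : 0 ≤ s) (h1 : s < Δ) :
    cell Δ (n * Δ + s) = n := by
  unfold cell
  rw [Int.floor_eq_iff, le_div_iff₀ hΔ, div_lt_iff₀ hΔ]
  constructor <;> linarith

theorem phase_eq (hΔ : 0 < Δ) (n : ℤ) {s : ℝ} (h0 : 0 ≤ s) (h1 : s < Δ) :
    phase Δ (n * Δ + s) = s := by
  unfold phase
  rw [cell_eq hΔ n h0 h1]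
  ring

theorem cell_add (hΔ : 0 < Δ) (t : ℝ) (n : ℤ) : cell Δ (t + n * Δ) = cell Δ t + n := by
  unfold cell
  rw [add_div, mul_div_cancel_right₀ _ hΔ.ne', Int.floor_add_intCast]

theorem phase_add (hΔ : 0 < Δ) (t : ℝ) (n : ℤ) : phase Δ (t + n * Δ) = phase Δ t := by
  unfold phase
  rw [cell_add hΔ]
  push_cast
  ring

theorem cell_mono (hΔ : 0 < Δ) : Monotone (cell Δ) := fun _ _ h =>
  Int.floor_le_floor (div_le_div_of_nonneg_right h hΔ.le)

theorem measurable_cell : Measurable (cell Δ) :=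
  Int.measurable_floor.comp (measurable_id.div_const Δ)

theorem measurable_phase : Measurable (phase Δ) :=
  measurable_id.sub ((measurable_from_top.comp measurable_cell).mul_const Δ)

theorem measurable_cell_phase {f : ℤ → ℝ → ℝ} (hf : ∀ k, Measurable (f k)) :
    Measurable fun t => f (cell Δ t) (phase Δ t) := by
  have h : Measurable fun q : ℝ × ℤ => f q.2 q.1 := measurable_from_prod_countable_left hf
  exact h.comp (measurable_phase.prodMk measurable_cell)

variable [Fintype E] {R : E → E → ℝ} {p : E → ℝ} {K : ℕ} [NeZero K] {m : E → E → ℕ}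
  {L C : ZMod K → E → ℝ} {y : ZMod K × E → ℝ} {Z w : ℝ → ZMod K × E → ℝ}

/-- The function on the line with value `f k (phase)` on the cells congruent to `k` mod `K`. -/
noncomputable def roll (Δ : ℝ) (f : ℝ → ZMod K × E → ℝ) (t : ℝ) (i : E) : ℝ :=
  f (phase Δ t) ((cell Δ t : ZMod K), i)

omit [Fintype E] [NeZero K] in
theorem roll_sub (hΔ : 0 < Δ) (f : ℝ → ZMod K × E → ℝ) (t : ℝ) (n : ℕ) (i : E) :
    roll Δ f (t - n * Δ) i = f (phase Δ t) ((cell Δ t : ZMod K) - (n : ZMod K), i) := by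
  have h : t - n * Δ = t + ((-n : ℤ) : ℝ) * Δ := by
    push_cast
    ring
  unfold roll
  rw [h, phase_add hΔ, cell_add hΔ]
  congr 2
  push_cast
  ring

omit [Fintype E] [NeZero K] in
theorem roll_add_period (hΔ : 0 < Δ) (f : ℝ → ZMod K × E → ℝ) (t : ℝ) (i : E) :
    roll Δ f (t + K * Δ) i = roll Δ f t i := by
  have h : t + K * Δ = t + ((K : ℤ) : ℝ) * Δ := by push_cast; rfl
  unfold roll
  rw [h, phase_add hΔ, cell_add hΔ]
  congr 2
  push_cast
  simp

omit [Fintype E] [NeZero K] in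
theorem measurable_roll {f : ℝ → ZMod K × E → ℝ} (hf : ∀ n, Measurable fun t => f t n) (i : E) :
    Measurable fun t => roll Δ f t i :=
  measurable_cell_phase (f := fun k s => f s ((k : ZMod K), i)) fun _ => hf _

omit [Fintype E] [NeZero K] in
theorem roll_cell (hΔ : 0 < Δ) (f : ℝ → ZMod K × E → ℝ) (n : ℤ) {s : ℝ} (h0 : 0 ≤ s)
    (h1 : s < Δ) (i : E) : roll Δ f (n * Δ + s) i = f s ((n : ZMod K), i) := by
  unfold roll
  rw [phase_eq hΔ n h0 h1, cell_eq hΔ n h0 h1]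

theorem intervalIntegrable_of_bounded {f : ℝ → ℝ} (hf : Measurable f) {B : ℝ}
    (hB : ∀ t, |f t| ≤ B) (a b : ℝ) : IntervalIntegrable f volume a b := by
  rw [intervalIntegrable_iff]
  exact Measure.integrableOn_of_bounded (M := B) (by simp) hf.aestronglyMeasurable
    (Filter.Eventually.of_forall hB)

theorem intervalIntegrable_sum {ι : Type*} [Fintype ι] {f : ι → ℝ → ℝ} {a b : ℝ}
    (hf : ∀ j, IntervalIntegrable (f j) volume a b) :
    IntervalIntegrable (fun t => ∑ j, f j t) volume a b := by
  have := IntervalIntegrable.sum Finset.univ fun j _ => hf j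
  simpa only [Finset.sum_fn] using this

/-- Inflow and capacity profiles that are constant on cells. -/
noncomputable def cellwise (Δ : ℝ) (L : ZMod K → E → ℝ) (t : ℝ) (i : E) : ℝ :=
  L (cell Δ t : ZMod K) i

omit [Fintype E] in
theorem cellwise_intervalIntegrable (L : ZMod K → E → ℝ) (i : E) (a b : ℝ) :
    IntervalIntegrable (fun t => cellwise Δ L t i) volume a b := by
  refine intervalIntegrable_of_bounded (B := ∑ k, |L k i|) ?_ (fun t => ?_) a b
  · exact (measurable_from_top (f := fun k : ℤ => L (k : ZMod K) i)).comp measurable_cell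
  · exact Finset.single_le_sum (f := fun k => |L k i|) (fun k _ => abs_nonneg _)
      (Finset.mem_univ _)

namespace FluidPath

theorem rate_abs_le (h : FluidPath (unrolled R m) (fun u => C u.1 u.2) (fun u => L u.1 u.2) y Z w)
    (hp : IsWeight R p) (t : ℝ) (n : ZMod K × E) : |w t n| ≤ ∑ u : ZMod K × E, C u.1 u.2 := by
  rw [abs_of_nonneg (h.rate_nonneg hp.unrolled t n)]
  exact (h.rate_le_cap t n).trans
    (Finset.single_le_sum (f := fun u : ZMod K × E => C u.1 u.2) (fun u _ => h.cap_nonneg u)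
      (Finset.mem_univ n))

theorem measurable_roll_rate
    (h : FluidPath (unrolled R m) (fun u => C u.1 u.2) (fun u => L u.1 u.2) y Z w)
    (hp : IsWeight R p) (i : E) : Measurable fun t => roll Δ w t i :=
  measurable_roll (fun n => (h.rate_antitone hp.unrolled n).measurable) i

theorem roll_rate_intervalIntegrable
    (h : FluidPath (unrolled R m) (fun u => C u.1 u.2) (fun u => L u.1 u.2) y Z w)
    (hp : IsWeight R p) (i : E) (d a b : ℝ) :
    IntervalIntegrable (fun t => roll Δ w (t - d) i) volume a b :=
  intervalIntegrable_of_bounded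
    ((h.measurable_roll_rate hp i).comp (measurable_id.sub_const d))
    (fun _ => h.rate_abs_le hp _ _) a b

theorem roll_rate_pwcOn
    (h : FluidPath (unrolled R m) (fun u => C u.1 u.2) (fun u => L u.1 u.2) y Z w)
    (hp : IsWeight R p) (hΔ : 0 < Δ) (i : E) (a b : ℝ) :
    PwcOn (fun t => roll Δ w t i) (Set.Ico a b) := by
  classical
  choose D hD using h.exists_breakpoints hp.unrolled
  refine ⟨(Finset.Icc (cell Δ a) (cell Δ b)).biUnion fun n => insert ((n : ℝ) * Δ)
    (Finset.univ.biUnion fun v => (D v).image fun d => (n : ℝ) * Δ + d), ?_⟩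
  intro s hs t ht hst hno
  have hmem : ∀ r ∈ Set.Ico a b, cell Δ r ∈ Finset.Icc (cell Δ a) (cell Δ b) := fun r hr =>
    Finset.mem_Icc.2 ⟨cell_mono hΔ hr.1, cell_mono hΔ hr.2.le⟩
  have hcell : cell Δ s = cell Δ t := by
    by_contra hne
    have hlt : cell Δ s < cell Δ t := lt_of_le_of_ne (cell_mono hΔ hst) hne
    refine hno (cell Δ t * Δ) ?_ ⟨?_, ?_⟩
    · exact Finset.mem_biUnion.2 ⟨_, hmem t ht, Finset.mem_insert_self _ _⟩
    · have h1 : (cell Δ s : ℝ) + 1 ≤ cell Δ t := by exact_mod_cast hlt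
      have h2 := mul_le_mul_of_nonneg_right h1 hΔ.le
      have h3 := cell_add_phase (Δ := Δ) s
      have h4 := phase_lt hΔ s
      linarith
    · have h3 := cell_add_phase (Δ := Δ) t
      have h4 := phase_nonneg hΔ t
      linarith
  have hs' := cell_add_phase (Δ := Δ) s
  have ht' := cell_add_phase (Δ := Δ) t
  rw [← hcell] at ht'
  dsimp only [roll]
  rw [← hcell]
  refine hD _ _ _ (phase_nonneg hΔ s) (by linarith) fun d hd hmemd => ?_
  refine hno (cell Δ s * Δ + d) ?_ ⟨by linarith [hmemd.1], by linarith [hmemd.2]⟩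
  exact Finset.mem_biUnion.2 ⟨_, hmem s hs, Finset.mem_insert_of_mem
    (Finset.mem_biUnion.2 ⟨_, Finset.mem_univ _, Finset.mem_image_of_mem _ hd⟩)⟩

/-- The queue lengths along a fluid path of the unfolded network. -/
noncomputable def queues (R : E → E → ℝ) (m : E → E → ℕ) (L : ZMod K → E → ℝ)
    (y : ZMod K × E → ℝ) (Z : ℝ → ZMod K × E → ℝ) (t : ℝ) (n : ZMod K × E) : ℝ :=
  y n + t * L n.1 n.2 + ∑ u, unrolled R m u n * Z t u - Z t n

theorem integral_cell
    (h : FluidPath (unrolled R m) (fun u => C u.1 u.2) (fun u => L u.1 u.2) y Z w)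
    (hp : IsWeight R p) (hΔ : 0 < Δ) (n : ℤ) {s : ℝ} (h0 : 0 ≤ s) (h1 : s ≤ Δ) (i : E) :
    ∫ r in (n * Δ : ℝ)..(n * Δ + s), (cellwise Δ L r i +
      ∑ j, R j i * roll Δ w (r - m j i * Δ) j - roll Δ w r i) =
      queues R m L y Z s ((n : ZMod K), i) - y ((n : ZMod K), i) := by
  have hw : ∀ v, IntervalIntegrable (fun r => w r v) volume 0 s := fun v =>
    (h.rate_antitone hp.unrolled v).intervalIntegrable
  have hshift := intervalIntegral.integral_comp_add_left (a := 0) (b := s)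
    (fun r => cellwise Δ L r i + ∑ j, R j i * roll Δ w (r - m j i * Δ) j - roll Δ w r i)
    (n * Δ : ℝ)
  rw [add_zero] at hshift
  rw [← hshift, intervalIntegral.integral_congr_Ioo_of_le h0
    (g := fun r => L (n : ZMod K) i + ∑ u, unrolled R m u ((n : ZMod K), i) * w r u -
      w r ((n : ZMod K), i))]
  · rw [intervalIntegral.integral_sub, intervalIntegral.integral_add,
      intervalIntegral.integral_finsetSum, h.integral_rate hp.unrolled h0]
    · simp only [intervalIntegral.integral_const_mul, h.integral_rate hp.unrolled h0,
        intervalIntegral.integral_const, smul_eq_mul, sub_zero, queues]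
      ring
    · exact fun u _ => (hw u).const_mul _
    · exact intervalIntegrable_const
    · exact intervalIntegrable_sum fun u => (hw u).const_mul _
    · exact intervalIntegrable_const.add (intervalIntegrable_sum fun u => (hw u).const_mul _)
    · exact hw _
  · intro r hr
    have hr1 := hr.2.trans_le h1
    dsimp only
    rw [roll_cell hΔ w n hr.1.le hr1, cellwise, cell_eq hΔ n hr.1.le hr1,
      sum_unrolled (fun u => w r u)]
    congr 2
    refine Finset.sum_congr rfl fun j _ => ?_
    rw [roll_sub hΔ, phase_eq hΔ n hr.1.le hr1, cell_eq hΔ n hr.1.le hr1]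

theorem roll_isSolution
    (h : FluidPath (unrolled R m) (fun u => C u.1 u.2) (fun u => L u.1 u.2) y Z w)
    (hR : ∀ j i, 0 ≤ R j i) (hp : IsWeight R p) (hΔ : 0 < Δ)
    (hy : ∀ k i, queues R m L y Z Δ (k, i) = y (k + 1, i)) :
    IsSolution R (fun j i => m j i * Δ) (cellwise Δ L) (cellwise Δ C)
      (roll Δ (queues R m L y Z)) (roll Δ w) := by
  have hloc : ∀ t, LocalEq R (fun j i => m j i * Δ) (cellwise Δ L) (cellwise Δ C)
      (roll Δ (queues R m L y Z)) (roll Δ w) t := by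
    intro t i
    have hr := h.rate (phase Δ t) (phase_nonneg hΔ t) ((cell Δ t : ZMod K), i)
    have hs : ∑ j, R j i * roll Δ w (t - m j i * Δ) j =
        ∑ u, unrolled R m u ((cell Δ t : ZMod K), i) * w (phase Δ t) u := by
      rw [sum_unrolled (fun u => w (phase Δ t) u)]
      exact Finset.sum_congr rfl fun j _ => by rw [roll_sub hΔ]
    rw [hs]
    exact hr
  refine ⟨fun t _ i => h.queue_nonneg (phase_nonneg hΔ t) _,
    fun t _ i => h.rate_nonneg hp.unrolled _ _, fun i => ?_, fun t _ => (hloc t).feasibleAt,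
    fun t _ v hv => (hloc t).maximal hR hp hv, fun t ht i => ?_⟩
  · refine LocallyIntegrable.locallyIntegrableOn ?_ _
    rw [locallyIntegrable_iff]
    intro k hk
    exact Measure.integrableOn_of_bounded (M := ∑ u : ZMod K × E, C u.1 u.2)
      hk.measure_lt_top.ne (h.measurable_roll_rate hp i).aestronglyMeasurable
      (Filter.Eventually.of_forall fun _ => h.rate_abs_le hp _ _)
  · have hnetI : ∀ a b, IntervalIntegrable (fun r => cellwise Δ L r i +
        ∑ j, R j i * roll Δ w (r - m j i * Δ) j - roll Δ w r i) volume a b := by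
      intro a b
      refine ((cellwise_intervalIntegrable L i a b).add
        (intervalIntegrable_sum fun j =>
          (h.roll_rate_intervalIntegrable hp j _ a b).const_mul _)).sub ?_
      simpa using h.roll_rate_intervalIntegrable hp i 0 a b
    have hstart : roll Δ (queues R m L y Z) 0 i = y (0, i) := by
      have := roll_cell hΔ (queues R m L y Z) 0 le_rfl hΔ i
      simpa [queues, h.cum_zero hp.unrolled] using this
    have hcells : ∀ n : ℕ, y ((n : ZMod K), i) = y (0, i) + ∫ r in (0:ℝ)..(n * Δ),
        (cellwise Δ L r i + ∑ j, R j i * roll Δ w (r - m j i * Δ) j - roll Δ w r i) := by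
      intro n
      induction n with
      | zero => simp
      | succ n ih =>
        have h1 := h.integral_cell hp hΔ n hΔ.le le_rfl i
        have h2 := intervalIntegral.integral_add_adjacent_intervals (hnetI 0 (n * Δ))
          (hnetI (n * Δ) (n * Δ + Δ))
        have h3 := hy n i
        push_cast at h1 h2 h3 ⊢
        rw [add_mul, one_mul, ← h2, ← h3]
        linarith
    have hn : ((cell Δ t).toNat : ℤ) = cell Δ t :=
      Int.toNat_of_nonneg (Int.floor_nonneg.2 (div_nonneg ht hΔ.le))
    have h1 := h.integral_cell hp hΔ (cell Δ t) (phase_nonneg hΔ t) (phase_lt hΔ t).le i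
    have h2 := intervalIntegral.integral_add_adjacent_intervals (hnetI 0 (cell Δ t * Δ))
      (hnetI (cell Δ t * Δ) t)
    have h3 := hcells (cell Δ t).toNat
    have hnR : (((cell Δ t).toNat : ℕ) : ℝ) = cell Δ t := by exact_mod_cast hn
    have hnZ : (((cell Δ t).toNat : ℕ) : ZMod K) = cell Δ t := by
      rw [← Int.cast_natCast, hn]
    rw [hnR, hnZ] at h3
    rw [cell_add_phase] at h1
    rw [hstart, ← h2]
    change queues R m L y Z (phase Δ t) ((cell Δ t : ZMod K), i) = _
    linarith

end FluidPath

theorem exists_periodic_solution (hR : ∀ j i, 0 ≤ R j i) (hp : IsWeight R p) (hΔ : 0 < Δ)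
    (hL : ∀ k i, 0 ≤ L k i) (hC : ∀ k i, 0 ≤ C k i)
    (hstab : ∀ i, ∑ k, (L k i + ∑ j, R j i * C k j - C k i) < 0) :
    ∃ xs zs : ℝ → E → ℝ,
      IsSolution R (fun j i => m j i * Δ) (cellwise Δ L) (cellwise Δ C) xs zs ∧
      (∀ i a b, PwcOn (fun t => zs t i) (Set.Ico a b)) ∧
      (∀ t i, xs (t + K * Δ) i = xs t i) ∧ ∀ t i, zs (t + K * Δ) i = zs t i := by
  obtain ⟨y, hy0, hy⟩ := exists_periodic_init (m := m) hR hp hΔ hL hC hstab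
  obtain ⟨Z, w, h⟩ := exists_fluidPath (Q := unrolled R m) (c := fun u : ZMod K × E => C u.1 u.2)
    (a := fun u => L u.1 u.2) (unrolled_nonneg hR) (fun u => hC _ _) (fun u => hL _ _) hy0
  exact ⟨_, _, h.roll_isSolution hR hp hΔ (hy Z w h), fun i a b => h.roll_rate_pwcOn hp hΔ i a b,
    fun t i => roll_add_period hΔ _ t i, fun t i => roll_add_period hΔ _ t i⟩

end Assembly

section Contraction

open Filter Topology Set

theorem AbsolutelyContinuousOnInterval.abs {f : ℝ → ℝ} {a b : ℝ}
    (hf : AbsolutelyContinuousOnInterval f a b) :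
    AbsolutelyContinuousOnInterval (fun t => |f t|) a b := by
  rw [absolutelyContinuousOnInterval_iff] at hf ⊢
  intro ε hε
  obtain ⟨d, hd, h⟩ := hf ε hε
  refine ⟨d, hd, fun I hI hlen => lt_of_le_of_lt (Finset.sum_le_sum fun i _ => ?_) (h I hI hlen)⟩
  simp only [Real.dist_eq]
  exact abs_abs_sub_abs_le_abs_sub _ _

theorem abs_le_add_integral {e g h : ℝ → ℝ} {a b : ℝ} (hab : a ≤ b)
    (hg : IntervalIntegrable g volume a b) (hh : IntervalIntegrable h volume a b)
    (he : ∀ t ∈ Icc a b, e t = e a + ∫ s in a..t, g s)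
    (hpos : ∀ t ∈ Icc a b, 0 < e t → g t ≤ h t) (hneg : ∀ t ∈ Icc a b, e t < 0 → -g t ≤ h t)
    (hzero : ∀ t ∈ Icc a b, e t = 0 → 0 ≤ h t) :
    |e b| ≤ |e a| + ∫ s in a..b, h s := by
  set F : ℝ → ℝ := fun t => e a + ∫ s in a..t, g s with hF
  have hac : AbsolutelyContinuousOnInterval F a b :=
    (LipschitzWith.const (e a)).lipschitzOnWith.absolutelyContinuousOnInterval.add
      (hg.absolutelyContinuousOnInterval_intervalIntegral left_mem_uIcc)
  have hFe : ∀ t ∈ Icc a b, F t = e t := fun t ht => (he t ht).symm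
  have hle : ∫ s in a..b, deriv (fun t => |F t|) s ≤ ∫ s in a..b, h s := by
    refine intervalIntegral.integral_mono_ae_restrict hab hac.abs.intervalIntegrable_deriv hh ?_
    rw [EventuallyLE, ae_restrict_iff' measurableSet_Icc]
    filter_upwards [hg.ae_hasDerivAt_integral] with t ht htI
    have hd : HasDerivAt F (g t) t :=
      (ht (by rwa [uIcc_of_le hab]) a left_mem_uIcc).const_add (e a)
    rcases lt_trichotomy (F t) 0 with h0 | h0 | h0
    · have := (hasDerivAt_abs_neg h0).comp t hd
      rw [show (fun t => |F t|) = (fun x => |x|) ∘ F from rfl, this.deriv]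
      have := hneg t htI (hFe t htI ▸ h0)
      linarith
    · have : IsLocalMin (fun t => |F t|) t :=
        Eventually.of_forall fun u => by simp [h0]
      rw [this.deriv_eq_zero]
      exact hzero t htI (hFe t htI ▸ h0)
    · have := (hasDerivAt_abs_pos h0).comp t hd
      rw [show (fun t => |F t|) = (fun x => |x|) ∘ F from rfl, this.deriv]
      have := hpos t htI (hFe t htI ▸ h0)
      linarith
  rw [hac.abs.integral_deriv_eq_sub, hFe b ⟨hab, le_rfl⟩, hFe a ⟨le_rfl, hab⟩] at hle
  linarith

variable [Fintype E] {R δ : E → E → ℝ} {lam c x z x' z' : ℝ → E → ℝ} {p : E → ℝ} {T : ℝ}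

theorem dbar_bddAbove (R δ : E → E → ℝ) :
    BddAbove (insert 0 {d : ℝ | ∃ j i, 0 < R j i ∧ δ j i = d}) := by
  refine ((Set.finite_range fun q : E × E => δ q.1 q.2).subset ?_).insert 0 |>.bddAbove
  rintro d ⟨j, i, -, rfl⟩
  exact ⟨(j, i), rfl⟩

theorem dbar_nonneg (R δ : E → E → ℝ) : 0 ≤ dbar R δ :=
  le_csSup (dbar_bddAbove R δ) (mem_insert _ _)

theorem le_dbar {j i : E} (h : 0 < R j i) : δ j i ≤ dbar R δ :=
  le_csSup (dbar_bddAbove R δ) (mem_insert_of_mem _ ⟨j, i, h, rfl⟩)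

/-- The difference of two outflows along a link. -/
def gap (z z' : ℝ → E → ℝ) (j : E) (t : ℝ) : ℝ := |z t j - z' t j|

omit [Fintype E] in
theorem gap_nonneg (z z' : ℝ → E → ℝ) (j : E) (t : ℝ) : 0 ≤ gap z z' j t := abs_nonneg _

theorem abs_min_sub_le {a b : E → ℝ} (hR : ∀ j i, 0 ≤ R j i) (i : E) (q l : ℝ) :
    |min q (l + ∑ j, R j i * a j) - min q (l + ∑ j, R j i * b j)| ≤ ∑ j, R j i * |a j - b j| := by
  refine (abs_min_sub_min_le_max _ _ _ _).trans ?_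
  simp only [sub_self, abs_zero, add_sub_add_left_eq_sub, ← Finset.sum_sub_distrib, ← mul_sub]
  refine max_le (Finset.sum_nonneg fun j _ => mul_nonneg (hR j i) (abs_nonneg _)) ?_
  refine (Finset.abs_sum_le_sum_abs _ _).trans (Finset.sum_le_sum fun j _ => ?_)
  rw [abs_mul, abs_of_nonneg (hR j i)]

namespace IsSolution

theorem localEq (h : IsSolution R δ lam c x z) (hR : ∀ j i, 0 ≤ R j i) {t : ℝ} (ht : 0 ≤ t) :
    LocalEq R δ lam c x z t :=
  localEq_of_maximal hR (h.2.2.2.1 t ht) (h.2.2.2.2.1 t ht)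

theorem le_cap (h : IsSolution R δ lam c x z) {t : ℝ} (ht : 0 ≤ t) (i : E) : z t i ≤ c t i :=
  (h.2.2.2.1 t ht).1 i

theorem intervalIntegrable (h : IsSolution R δ lam c x z) (i : E) {a b : ℝ}
    (ha : -dbar R δ ≤ a) (hb : -dbar R δ ≤ b) :
    IntervalIntegrable (fun t => z t i) volume a b := by
  rw [intervalIntegrable_iff]
  refine ((h.2.2.1 i).integrableOn_compact_subset (t := uIcc a b) ?_ isCompact_uIcc).mono_set
    uIoc_subset_uIcc
  intro t ht
  exact (le_min ha hb).trans ht.1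

theorem intervalIntegrable_gap (h : IsSolution R δ lam c x z) (h' : IsSolution R δ lam c x' z')
    (i : E) {a b : ℝ} (ha : -dbar R δ ≤ a) (hb : -dbar R δ ≤ b) :
    IntervalIntegrable (gap z z' i) volume a b :=
  ((h.intervalIntegrable i ha hb).sub (h'.intervalIntegrable i ha hb)).abs

end IsSolution

theorem intervalIntegrable_delayed (hR : ∀ j i, 0 ≤ R j i) {f : ℝ → ℝ} {j : E} (i : E)
    (hf : ∀ a b, -dbar R δ ≤ a → -dbar R δ ≤ b → IntervalIntegrable f volume a b) {a b : ℝ}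
    (ha : 0 ≤ a) (hb : 0 ≤ b) :
    IntervalIntegrable (fun s => R j i * f (s - δ j i)) volume a b := by
  rcases (hR j i).eq_or_lt with h0 | h0
  · simp [← h0]
  · have hd := le_dbar (δ := δ) h0
    have := (hf (a - δ j i) (b - δ j i) (by linarith) (by linarith)).comp_sub_right (δ j i)
    simp only [sub_add_cancel] at this
    exact this.const_mul _

namespace IsSolution

theorem intervalIntegrable_net (h : IsSolution R δ lam c x z) (hR : ∀ j i, 0 ≤ R j i)
    (hlam : ∀ i a b, IntervalIntegrable (fun t => lam t i) volume a b) (i : E) {a b : ℝ}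
    (ha : 0 ≤ a) (hb : 0 ≤ b) :
    IntervalIntegrable (fun s => lam s i + ∑ j, R j i * z (s - δ j i) j - z s i) volume a b := by
  have hd := dbar_nonneg R δ
  exact ((hlam i a b).add (intervalIntegrable_sum fun j => intervalIntegrable_delayed
    (f := fun t => z t j) hR i
    (fun _ _ => h.intervalIntegrable j) ha hb)).sub
    (h.intervalIntegrable i (by linarith) (by linarith))

theorem queue_eq (h : IsSolution R δ lam c x z) (hR : ∀ j i, 0 ≤ R j i)
    (hlam : ∀ i a b, IntervalIntegrable (fun t => lam t i) volume a b) (i : E) {a b : ℝ}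
    (ha : 0 ≤ a) (hb : 0 ≤ b) :
    x b i = x a i + ∫ s in a..b, (lam s i + ∑ j, R j i * z (s - δ j i) j - z s i) := by
  rw [h.2.2.2.2.2 b hb i, h.2.2.2.2.2 a ha i, add_assoc,
    intervalIntegral.integral_add_adjacent_intervals (h.intervalIntegrable_net hR hlam i le_rfl ha)
      (h.intervalIntegrable_net hR hlam i ha hb)]

/-- Rate of change of the difference of two queues. -/
theorem queue_sub_eq (h : IsSolution R δ lam c x z) (h' : IsSolution R δ lam c x' z')
    (hR : ∀ j i, 0 ≤ R j i)
    (hlam : ∀ i a b, IntervalIntegrable (fun t => lam t i) volume a b) (i : E) {a b : ℝ}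
    (ha : 0 ≤ a) (hb : 0 ≤ b) :
    x b i - x' b i = x a i - x' a i + ∫ s in a..b,
      (∑ j, R j i * (z (s - δ j i) j - z' (s - δ j i) j) - (z s i - z' s i)) := by
  rw [h.queue_eq hR hlam i ha hb, h'.queue_eq hR hlam i ha hb, add_sub_add_comm,
    ← intervalIntegral.integral_sub (h.intervalIntegrable_net hR hlam i ha hb)
      (h'.intervalIntegrable_net hR hlam i ha hb)]
  congr 2
  ext s
  simp only [mul_sub, Finset.sum_sub_distrib]
  ring

theorem gap_le_of_eq (h : IsSolution R δ lam c x z) (h' : IsSolution R δ lam c x' z')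
    (hR : ∀ j i, 0 ≤ R j i) {t : ℝ} (ht : 0 ≤ t) {i : E} (he : x t i = x' t i) :
    gap z z' i t ≤ ∑ j, R j i * gap z z' j (t - δ j i) := by
  have hs : 0 ≤ ∑ j, R j i * gap z z' j (t - δ j i) :=
    Finset.sum_nonneg fun j _ => mul_nonneg (hR j i) (gap_nonneg _ _ _ _)
  unfold gap at hs ⊢
  by_cases h0 : x t i = 0
  · rw [(h.localEq hR ht i).1 h0, (h'.localEq hR ht i).1 (he ▸ h0)]
    exact abs_min_sub_le hR i _ _
  · rw [(h.localEq hR ht i).2 h0, (h'.localEq hR ht i).2 (he ▸ h0)]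
    simpa using hs

theorem drift_le_of_lt (h : IsSolution R δ lam c x z) (h' : IsSolution R δ lam c x' z')
    (hR : ∀ j i, 0 ≤ R j i) {t : ℝ} (ht : 0 ≤ t) {i : E} (hlt : x' t i < x t i) :
    ∑ j, R j i * (z (t - δ j i) j - z' (t - δ j i) j) - (z t i - z' t i) ≤
      ∑ j, R j i * gap z z' j (t - δ j i) - gap z z' i t := by
  have h0 : x t i ≠ 0 := ((h'.1 t ht i).trans_lt hlt).ne'
  have hz := (h.localEq hR ht i).2 h0
  have hz' := h'.le_cap ht i
  have : gap z z' i t = z t i - z' t i := abs_of_nonneg (by linarith)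
  rw [this]
  gcongr with j
  · exact hR j i
  · exact le_abs_self _

theorem abs_queue_sub_le (h : IsSolution R δ lam c x z) (h' : IsSolution R δ lam c x' z')
    (hR : ∀ j i, 0 ≤ R j i)
    (hlam : ∀ i a b, IntervalIntegrable (fun t => lam t i) volume a b) (i : E) {a b : ℝ}
    (ha : 0 ≤ a) (hab : a ≤ b) :
    |x b i - x' b i| ≤ |x a i - x' a i| + ∫ s in a..b,
      (∑ j, R j i * gap z z' j (s - δ j i) - gap z z' i s) := by
  have hd := dbar_nonneg R δ
  have hb := ha.trans hab
  refine abs_le_add_integral (e := fun t => x t i - x' t i)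
    (g := fun s => ∑ j, R j i * (z (s - δ j i) j - z' (s - δ j i) j) - (z s i - z' s i)) hab ?_ ?_
    (fun t ht => h.queue_sub_eq h' hR hlam i ha (ha.trans ht.1))
    (fun t ht hlt => h.drift_le_of_lt h' hR (ha.trans ht.1) (by linarith))
    (fun t ht hlt => ?_) (fun t ht he => ?_)
  · exact (intervalIntegrable_sum fun j => intervalIntegrable_delayed
      (f := fun t => z t j - z' t j) hR i
      (fun _ _ ha hb => (h.intervalIntegrable j ha hb).sub (h'.intervalIntegrable j ha hb))
      ha hb).sub ((h.intervalIntegrable i (by linarith) (by linarith)).sub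
        (h'.intervalIntegrable i (by linarith) (by linarith)))
  · exact (intervalIntegrable_sum fun j => intervalIntegrable_delayed hR i
      (fun _ _ => h.intervalIntegrable_gap h' j) ha hb).sub
      (h.intervalIntegrable_gap h' i (by linarith) (by linarith))
  · have := h'.drift_le_of_lt h hR (ha.trans ht.1) (i := i) (by linarith)
    simp only [gap, abs_sub_comm (z' _ _)] at this
    refine le_trans (le_of_eq ?_) this
    simp only [mul_sub, Finset.sum_sub_distrib]
    ring
  · have := h.gap_le_of_eq h' hR (ha.trans ht.1) (i := i) (by linarith)
    linarith

theorem integral_delayed_gap_le (h : IsSolution R δ lam c x z) (h' : IsSolution R δ lam c x' z')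
    (hR : ∀ j i, 0 ≤ R j i) (hδ : ∀ j i, 0 ≤ δ j i) (j i : E) {a b u : ℝ} (hu : -dbar R δ ≤ u)
    (hua : u ≤ a - dbar R δ) (hab : a ≤ b) :
    ∫ s in a..b, R j i * gap z z' j (s - δ j i) ≤ R j i * ∫ s in u..b, gap z z' j s := by
  rw [intervalIntegral.integral_const_mul, intervalIntegral.integral_comp_sub_right]
  have hd := dbar_nonneg R δ
  rcases (hR j i).eq_or_lt with h0 | h0
  · simp [← h0]
  · have := le_dbar (δ := δ) h0
    have := hδ j i
    refine mul_le_mul_of_nonneg_left ?_ h0.le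
    exact intervalIntegral.integral_mono_interval (by linarith) (by linarith) (by linarith)
      (Eventually.of_forall fun s => gap_nonneg z z' j s)
      (h.intervalIntegrable_gap h' j hu (by linarith))

theorem integral_drift_eq (h : IsSolution R δ lam c x z) (h' : IsSolution R δ lam c x' z')
    (hR : ∀ j i, 0 ≤ R j i) (i : E) {a b : ℝ} (ha : 0 ≤ a) (hb : 0 ≤ b) :
    ∫ s in a..b, (∑ j, R j i * gap z z' j (s - δ j i) - gap z z' i s) =
      ∑ j, (∫ s in a..b, R j i * gap z z' j (s - δ j i)) - ∫ s in a..b, gap z z' i s := by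
  have hd := dbar_nonneg R δ
  have hi : ∀ j, IntervalIntegrable (fun s => R j i * gap z z' j (s - δ j i)) volume a b :=
    fun j => intervalIntegrable_delayed hR i (fun _ _ => h.intervalIntegrable_gap h' j) ha hb
  rw [intervalIntegral.integral_sub (intervalIntegrable_sum hi)
    (h.intervalIntegrable_gap h' i (by linarith) (by linarith)),
    intervalIntegral.integral_finsetSum fun j _ => hi j]

theorem integral_gap_le (h : IsSolution R δ lam c x z) (h' : IsSolution R δ lam c x' z')
    (hR : ∀ j i, 0 ≤ R j i) (hδ : ∀ j i, 0 ≤ δ j i) (hp : IsWeight R p)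
    (hlam : ∀ i a b, IntervalIntegrable (fun t => lam t i) volume a b) :
    ∃ B, ∀ t, 0 ≤ t → ∀ j, ∫ s in (0 : ℝ)..t, gap z z' j s ≤ B := by
  have hd := dbar_nonneg R δ
  set q : E → ℝ := fun j => p j - ∑ i, R j i * p i with hq
  have hq0 : ∀ j, 0 < q j := fun j => sub_pos.2 (hp.2 j)
  set G : E → ℝ := fun j => ∫ s in (-dbar R δ)..0, gap z z' j s with hG
  set C : ℝ := ∑ i, p i * (|x 0 i - x' 0 i| + ∑ j, R j i * G j) with hC
  have key : ∀ t, 0 ≤ t → ∑ j, q j * ∫ s in (0 : ℝ)..t, gap z z' j s ≤ C := by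
    intro t ht
    set F : E → ℝ := fun j => ∫ s in (0 : ℝ)..t, gap z z' j s with hF
    have h1 : ∀ i, 0 ≤ p i * (|x 0 i - x' 0 i| + ∑ j, R j i * (G j + F j) - F i) := by
      intro i
      refine mul_nonneg (hp.1 i).le ?_
      have h2 := (abs_nonneg _).trans (h.abs_queue_sub_le h' hR hlam i le_rfl ht)
      rw [h.integral_drift_eq h' hR i le_rfl ht] at h2
      have h3 : ∑ j, (∫ s in (0 : ℝ)..t, R j i * gap z z' j (s - δ j i)) ≤
          ∑ j, R j i * (G j + F j) := by
        refine Finset.sum_le_sum fun j _ => ?_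
        refine (h.integral_delayed_gap_le h' hR hδ j i le_rfl (by simp) ht).trans_eq ?_
        rw [hG, hF, intervalIntegral.integral_add_adjacent_intervals
          (h.intervalIntegrable_gap h' j le_rfl (by linarith))
          (h.intervalIntegrable_gap h' j (by linarith) (by linarith))]
      linarith
    have h2 := Finset.sum_nonneg fun i (_ : i ∈ Finset.univ) => h1 i
    have h3 : ∑ i, p i * (|x 0 i - x' 0 i| + ∑ j, R j i * (G j + F j) - F i) =
        C - ∑ j, q j * F j := by
      have h4 : ∑ j, (∑ i, R j i * p i) * F j = ∑ i, p i * ∑ j, R j i * F j := by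
        simp only [Finset.sum_mul, Finset.mul_sum]
        rw [Finset.sum_comm]
        exact Finset.sum_congr rfl fun i _ => Finset.sum_congr rfl fun j _ => by ring
      simp only [hC, hq, sub_mul, Finset.sum_sub_distrib, h4, mul_add, mul_sub,
        Finset.sum_add_distrib]
      ring
    rw [h3] at h2
    linarith
  have hF0 : ∀ t, 0 ≤ t → ∀ j, 0 ≤ ∫ s in (0 : ℝ)..t, gap z z' j s := fun t ht j =>
    intervalIntegral.integral_nonneg ht fun s _ => gap_nonneg z z' j s
  have hC0 : 0 ≤ C := by simpa using key 0 le_rfl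
  refine ⟨∑ j, C / q j, fun t ht j => ?_⟩
  have h1 : q j * ∫ s in (0 : ℝ)..t, gap z z' j s ≤ C :=
    (Finset.single_le_sum (f := fun j => q j * ∫ s in (0 : ℝ)..t, gap z z' j s)
      (fun j _ => mul_nonneg (hq0 j).le (hF0 t ht j)) (Finset.mem_univ j)).trans (key t ht)
  refine ((le_div_iff₀' (hq0 j)).2 h1).trans ?_
  exact Finset.single_le_sum (f := fun j => C / q j) (fun j _ => div_nonneg hC0 (hq0 j).le)
    (Finset.mem_univ j)

theorem eventually_integral_gap_le (h : IsSolution R δ lam c x z)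
    (h' : IsSolution R δ lam c x' z') (hR : ∀ j i, 0 ≤ R j i) (hδ : ∀ j i, 0 ≤ δ j i)
    (hp : IsWeight R p) (hlam : ∀ i a b, IntervalIntegrable (fun t => lam t i) volume a b)
    {ε : ℝ} (hε : 0 < ε) :
    ∀ᶠ u in atTop, 0 ≤ u ∧ ∀ j b, u ≤ b → ∫ s in u..b, gap z z' j s ≤ ε := by
  have hd := dbar_nonneg R δ
  obtain ⟨B, hB⟩ := h.integral_gap_le h' hR hδ hp hlam
  have hj : ∀ j, ∀ᶠ u in atTop, 0 ≤ u ∧ ∀ b, u ≤ b → ∫ s in u..b, gap z z' j s ≤ ε := by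
    intro j
    set F : ℝ → ℝ := fun t => ∫ s in (0 : ℝ)..t, gap z z' j s with hF
    have hadd : ∀ a b, 0 ≤ a → a ≤ b → F b = F a + ∫ s in a..b, gap z z' j s := fun a b ha hab =>
      (intervalIntegral.integral_add_adjacent_intervals
        (h.intervalIntegrable_gap h' j (by linarith) (by linarith))
        (h.intervalIntegrable_gap h' j (by linarith) (by linarith))).symm
    have hne : (F '' Ici 0).Nonempty := ⟨F 0, 0, mem_Ici.2 le_rfl, rfl⟩
    have hbd : BddAbove (F '' Ici 0) := ⟨B, by rintro _ ⟨t, ht, rfl⟩; exact hB t ht j⟩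
    obtain ⟨_, ⟨v, hv, rfl⟩, hlt⟩ := exists_lt_of_lt_csSup hne (sub_lt_self (sSup (F '' Ici 0)) hε)
    have hv : 0 ≤ v := hv
    filter_upwards [eventually_ge_atTop v] with u hu
    refine ⟨hv.trans hu, fun b hub => ?_⟩
    have h1 := hadd v u hv hu
    have h2 := hadd u b (hv.trans hu) hub
    have h3 : F b ≤ sSup (F '' Ici 0) := le_csSup hbd ⟨b, hv.trans (hu.trans hub), rfl⟩
    have h4 : 0 ≤ ∫ s in v..u, gap z z' j s :=
      intervalIntegral.integral_nonneg hu fun s _ => gap_nonneg z z' j s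
    linarith
  filter_upwards [eventually_all.2 hj, eventually_ge_atTop 0] with u hu h0
  exact ⟨h0, fun j => (hu j).2⟩

theorem exists_queue_eq_zero (h : IsSolution R δ lam c x z) (hR : ∀ j i, 0 ≤ R j i)
    (hT : 0 < T) (hlam : ∀ i a b, IntervalIntegrable (fun t => lam t i) volume a b)
    (hc : ∀ i a b, IntervalIntegrable (fun t => c t i) volume a b)
    (hlamT : ∀ i, Function.Periodic (fun t => lam t i) T)
    (hcT : ∀ i, Function.Periodic (fun t => c t i) T)
    (hstab : ∀ i, (∫ s in (0 : ℝ)..T, lam s i) + ∑ j, R j i * (∫ s in (0 : ℝ)..T, c s j) <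
      ∫ s in (0 : ℝ)..T, c s i) (i : E) (a : ℝ) :
    ∃ t, 0 ≤ t ∧ a ≤ t ∧ x t i = 0 := by
  by_contra! hne
  have hd := dbar_nonneg R δ
  set S := max a (dbar R δ)
  have hSa : a ≤ S := le_max_left _ _
  have hSd : dbar R δ ≤ S := le_max_right _ _
  have hS0 : 0 ≤ S := hd.trans hSd
  set ψ : ℝ → ℝ := fun s => lam s i + ∑ j, R j i * c (s - δ j i) j - c s i with hψ
  have hcd : ∀ j a b, IntervalIntegrable (fun s => R j i * c (s - δ j i) j) volume a b := by
    intro j a b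
    have := (hc j (a - δ j i) (b - δ j i)).comp_sub_right (δ j i)
    simp only [sub_add_cancel] at this
    exact this.const_mul _
  have hψi : ∀ a b, IntervalIntegrable ψ volume a b := fun a b =>
    ((hlam i a b).add (intervalIntegrable_sum fun j => hcd j a b)).sub (hc i a b)
  have hψT : Function.Periodic ψ T := by
    intro s
    have h1 : ∀ j, c (s + T - δ j i) j = c (s - δ j i) j := fun j => by
      rw [add_sub_right_comm]
      exact hcT j _
    simp only [hψ, h1]
    rw [show lam (s + T) i = lam s i from hlamT i s, show c (s + T) i = c s i from hcT i s]
  have hneg : ∫ s in (0 : ℝ)..T, ψ s < 0 := by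
    rw [intervalIntegral.integral_sub ((hlam i _ _).add (intervalIntegrable_sum fun j => hcd j _ _))
      (hc i _ _), intervalIntegral.integral_add (hlam i _ _)
      (intervalIntegrable_sum fun j => hcd j _ _),
      intervalIntegral.integral_finsetSum fun j _ => hcd j _ _]
    have h1 : ∀ j, ∫ s in (0 : ℝ)..T, R j i * c (s - δ j i) j =
        R j i * ∫ s in (0 : ℝ)..T, c s j := by
      intro j
      rw [intervalIntegral.integral_const_mul,
        intervalIntegral.integral_comp_sub_right (fun s => c s j)]
      have := (hcT j).intervalIntegral_add_eq (0 - δ j i) 0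
      rw [zero_add, show (0 : ℝ) - δ j i + T = T - δ j i by ring] at this
      rw [this]
    simp only [h1]
    linarith [hstab i]
  have hle : ∀ n : ℕ, 0 ≤ x S i + n * ∫ s in (0 : ℝ)..T, ψ s := by
    intro n
    have hST : S ≤ S + (n : ℤ) • T := by
      simp only [natCast_zsmul, nsmul_eq_mul, le_add_iff_nonneg_right]
      positivity
    have h1 := h.queue_eq hR hlam i hS0 (hS0.trans hST)
    have h2 := h.1 _ (hS0.trans hST) i
    have h3 : ∫ s in S..S + (n : ℤ) • T, (lam s i + ∑ j, R j i * z (s - δ j i) j - z s i) ≤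
        ∫ s in S..S + (n : ℤ) • T, ψ s := by
      refine intervalIntegral.integral_mono_on hST
        (h.intervalIntegrable_net hR hlam i hS0 (hS0.trans hST)) (hψi _ _) fun s hs => ?_
      have hs0 : 0 ≤ s := hS0.trans hs.1
      rw [(h.localEq hR hs0 i).2 (hne s hs0 (hSa.trans hs.1))]
      refine sub_le_sub_right (add_le_add_right (Finset.sum_le_sum fun j _ => ?_) _) _
      rcases (hR j i).eq_or_lt with h0 | h0
      · simp [← h0]
      · have := le_dbar (δ := δ) h0
        exact mul_le_mul_of_nonneg_left (h.le_cap (by linarith [hs.1]) j) h0.le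
    rw [hψT.intervalIntegral_add_zsmul_eq _ _ hψi, hψT.intervalIntegral_add_eq S 0, zero_add] at h3
    simp only [natCast_zsmul, nsmul_eq_mul] at h1 h2 h3
    linarith
  obtain ⟨n, hn⟩ := exists_nat_gt (x S i / -∫ s in (0 : ℝ)..T, ψ s)
  rw [div_lt_iff₀ (neg_pos.2 hneg)] at hn
  linarith [hle n]

theorem exists_queue_eq (h : IsSolution R δ lam c x z) (h' : IsSolution R δ lam c x' z')
    (hR : ∀ j i, 0 ≤ R j i) (hlam : ∀ i a b, IntervalIntegrable (fun t => lam t i) volume a b)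
    (i : E) (hx : ∀ a, ∃ t, 0 ≤ t ∧ a ≤ t ∧ x t i = 0)
    (hx' : ∀ a, ∃ t, 0 ≤ t ∧ a ≤ t ∧ x' t i = 0) (a : ℝ) :
    ∃ t, 0 ≤ t ∧ a ≤ t ∧ x t i = x' t i := by
  obtain ⟨u, hu0, hu, hxu⟩ := hx a
  obtain ⟨v, hv0, hv, hxv⟩ := hx' a
  have hcont : ∀ {x z : ℝ → E → ℝ}, IsSolution R δ lam c x z →
      ContinuousOn (fun t => x t i) (uIcc u v) := by
    intro x z h
    have := (intervalIntegral.continuousOn_primitive_interval' (h.intervalIntegrable_net hR hlam i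
      hu0 hv0) left_mem_uIcc).const_add (x u i)
    exact this.congr fun t ht => h.queue_eq hR hlam i hu0 ((le_min hu0 hv0).trans ht.1)
  have hivt := intermediate_value_uIcc ((hcont h).sub (hcont h'))
  obtain ⟨t, ht, hxt⟩ := hivt (show (0 : ℝ) ∈ _ from by
    have h1 := h'.1 u hu0 i
    have h2 := h.1 v hv0 i
    refine Icc_subset_uIcc ⟨?_, ?_⟩
    · simpa [hxu] using h1
    · simpa [hxv] using h2)
  exact ⟨t, (le_min hu0 hv0).trans ht.1, (le_min hu hv).trans ht.1, sub_eq_zero.1 hxt⟩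

theorem tendsto_queue_sub (h : IsSolution R δ lam c x z) (h' : IsSolution R δ lam c x' z')
    (hR : ∀ j i, 0 ≤ R j i) (hδ : ∀ j i, 0 ≤ δ j i) (hp : IsWeight R p)
    (hlam : ∀ i a b, IntervalIntegrable (fun t => lam t i) volume a b) (i : E)
    (hx : ∀ a, ∃ t, 0 ≤ t ∧ a ≤ t ∧ x t i = x' t i) :
    Tendsto (fun t => |x t i - x' t i|) atTop (𝓝 0) := by
  have hd := dbar_nonneg R δ
  have hS : 0 ≤ ∑ j, R j i := Finset.sum_nonneg fun j _ => hR j i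
  refine (tendsto_order.2 ⟨fun b hb => Eventually.of_forall fun t => hb.trans_le (abs_nonneg _),
    fun ε hε => ?_⟩)
  obtain ⟨u, hu0, hu⟩ := (h.eventually_integral_gap_le h' hR hδ hp hlam
    (div_pos hε (by linarith : 0 < ∑ j, R j i + 1))).exists
  obtain ⟨v, hv0, hv, hxv⟩ := hx (u + dbar R δ)
  filter_upwards [eventually_ge_atTop v] with t ht
  have h1 := h.abs_queue_sub_le h' hR hlam i hv0 ht
  rw [h.integral_drift_eq h' hR i hv0 (hv0.trans ht), hxv, sub_self, abs_zero, zero_add] at h1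
  have h2 : 0 ≤ ∫ s in v..t, gap z z' i s :=
    intervalIntegral.integral_nonneg ht fun s _ => gap_nonneg z z' i s
  have h3 : ∑ j, (∫ s in v..t, R j i * gap z z' j (s - δ j i)) ≤
      ∑ j, R j i * (ε / (∑ j, R j i + 1)) := Finset.sum_le_sum fun j _ =>
    (h.integral_delayed_gap_le h' hR hδ j i (by linarith) (by linarith) ht).trans
      (mul_le_mul_of_nonneg_left (hu j t (by linarith)) (hR j i))
  rw [← Finset.sum_mul] at h3
  have h4 : (∑ j, R j i) * (ε / (∑ j, R j i + 1)) < ε := by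
    rw [mul_div_assoc', div_lt_iff₀ (by linarith)]
    nlinarith
  linarith

theorem tendsto_integral_gap (h : IsSolution R δ lam c x z) (h' : IsSolution R δ lam c x' z')
    (hR : ∀ j i, 0 ≤ R j i) (hδ : ∀ j i, 0 ≤ δ j i) (hp : IsWeight R p)
    (hlam : ∀ i a b, IntervalIntegrable (fun t => lam t i) volume a b) (j : E) (d : ℝ)
    (hd0 : 0 ≤ d) :
    Tendsto (fun t => ∫ s in (t - d)..t, gap z z' j s) atTop (𝓝 0) := by
  refine (tendsto_order.2 ⟨fun b hb => Eventually.of_forall fun t => hb.trans_le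
    (intervalIntegral.integral_nonneg (by linarith) fun s _ => gap_nonneg z z' j s),
    fun ε hε => ?_⟩)
  have h1 := h.eventually_integral_gap_le h' hR hδ hp hlam (half_pos hε)
  have h2 : Tendsto (fun t : ℝ => t - d) atTop atTop := tendsto_atTop_add_const_right _ _ tendsto_id
  filter_upwards [h2.eventually h1] with t ht
  exact (ht.2 j t (by linarith)).trans_lt (by linarith)

theorem outflow_eq_of_periodic (h : IsSolution R δ lam c x z) (h' : IsSolution R δ lam c x' z')
    (hR : ∀ j i, 0 ≤ R j i) (hp : IsWeight R p) (hT : 0 < T)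
    (hcB : ∀ i, ∃ B, ∀ t, c t i ≤ B) (hxx : ∀ t, 0 ≤ t → ∀ i, x t i = x' t i)
    (hzT : ∀ t, -dbar R δ ≤ t → ∀ i, z (t + T) i = z t i)
    (hzT' : ∀ t, -dbar R δ ≤ t → ∀ i, z' (t + T) i = z' t i) {t : ℝ} (ht : 0 ≤ t) (i : E) :
    z t i = z' t i := by
  have hd := dbar_nonneg R δ
  have hgT : ∀ j (n : ℕ) t, -dbar R δ ≤ t → gap z z' j (t + n * T) = gap z z' j t := by
    intro j n t ht
    induction n with
    | zero => simp
    | succ n ih =>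
      have h0 : -dbar R δ ≤ t + n * T := by
        have : 0 ≤ n * T := by positivity
        linarith
      rw [← ih, gap, gap, ← hzT _ h0, ← hzT' _ h0]
      push_cast
      ring_nf
  have hshift : ∀ t : ℝ, ∃ n : ℕ, dbar R δ ≤ t + n * T := by
    intro t
    obtain ⟨n, hn⟩ := exists_nat_ge ((dbar R δ - t) / T)
    rw [div_le_iff₀ hT] at hn
    exact ⟨n, by linarith⟩
  have hbd : ∀ j, BddAbove (gap z z' j '' Ici (-dbar R δ)) := by
    intro j
    obtain ⟨B, hB⟩ := hcB j
    refine ⟨B, ?_⟩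
    rintro _ ⟨t, ht, rfl⟩
    obtain ⟨n, hn⟩ := hshift t
    have h0 := hd.trans hn
    have h0' : -dbar R δ ≤ t + n * T := by linarith
    rw [← hgT j n t ht]
    refine abs_sub_le_iff.2 ⟨?_, ?_⟩
    · linarith [h.le_cap h0 j, h'.2.1 _ h0' j, hB (t + n * T)]
    · linarith [h'.le_cap h0 j, h.2.1 _ h0' j, hB (t + n * T)]
  set s : E → ℝ := fun j => sSup (gap z z' j '' Ici (-dbar R δ)) with hs
  have hle : ∀ j t, -dbar R δ ≤ t → gap z z' j t ≤ s j := fun j t ht =>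
    le_csSup (hbd j) ⟨t, ht, rfl⟩
  have hs0 : ∀ j, 0 ≤ s j := fun j => (gap_nonneg z z' j 0).trans (hle j 0 (by linarith))
  have hzero := hp.eq_zero hs0 (fun i => by
    refine csSup_le ⟨_, 0, mem_Ici.2 (by linarith), rfl⟩ ?_
    rintro _ ⟨t, ht, rfl⟩
    obtain ⟨n, hn⟩ := hshift t
    rw [← hgT i n t ht]
    refine (h.gap_le_of_eq h' hR (hd.trans hn) (hxx _ (hd.trans hn) i)).trans ?_
    refine Finset.sum_le_sum fun j _ => ?_
    rcases (hR j i).eq_or_lt with h0 | h0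
    · simp [← h0]
    · have := le_dbar (δ := δ) h0
      exact mul_le_mul_of_nonneg_left (hle j _ (by linarith)) h0.le)
  have := hle i t (by linarith)
  rw [hzero i] at this
  exact sub_eq_zero.1 (abs_nonpos_iff.1 this)

end IsSolution

theorem eq_of_periodic_of_tendsto {f : ℝ → ℝ} (hT : 0 < T) (hf : ∀ t, 0 ≤ t → f (t + T) = f t)
    (hlim : Tendsto (fun t => |f t|) atTop (𝓝 0)) {t : ℝ} (ht : 0 ≤ t) : f t = 0 := by
  have hn : ∀ n : ℕ, f (t + n * T) = f t := by
    intro n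
    induction n with
    | zero => simp
    | succ n ih =>
      rw [← ih, ← hf (t + n * T) (by positivity)]
      push_cast
      ring_nf
  have h1 : Tendsto (fun n : ℕ => t + n * T) atTop atTop :=
    tendsto_atTop_add_const_left _ _ (tendsto_natCast_atTop_atTop.atTop_mul_const hT)
  have h2 := hlim.comp h1
  simp only [Function.comp_def, hn] at h2
  exact abs_eq_zero.1 (tendsto_nhds_unique tendsto_const_nhds h2)

end Contraction

section CellwiseData

variable [Fintype E] {R δ : E → E → ℝ} {lam c lam' c' x z : ℝ → E → ℝ} {T Δ : ℝ} {K : ℕ}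

theorem FeasibleAt.congr {t : ℝ} {w : E → ℝ} (hlam : ∀ i, lam t i = lam' t i)
    (hc : ∀ i, c t i = c' t i) (h : FeasibleAt R δ lam c x z t w) :
    FeasibleAt R δ lam' c' x z t w :=
  ⟨fun i => hc i ▸ h.1 i, fun i hi => hlam i ▸ h.2 i hi⟩

theorem IsSolution.congr (hlam : ∀ t, 0 ≤ t → ∀ i, lam t i = lam' t i)
    (hc : ∀ t, 0 ≤ t → ∀ i, c t i = c' t i) (h : IsSolution R δ lam c x z) :
    IsSolution R δ lam' c' x z := by
  obtain ⟨h1, h2, h3, h4, h5, h6⟩ := h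
  refine ⟨h1, h2, h3, fun t ht => (h4 t ht).congr (hlam t ht) (hc t ht), fun t ht w hw =>
    h5 t ht w (hw.congr (fun i => (hlam t ht i).symm) fun i => (hc t ht i).symm),
    fun t ht i => ?_⟩
  rw [h6 t ht i]
  congr 1
  refine intervalIntegral.integral_congr fun s hs => ?_
  rw [Set.uIcc_of_le ht] at hs
  simp only [hlam s hs.1 i]

omit [Fintype E] in
theorem cellwise_periodic (hΔ : 0 < Δ) (L : ZMod K → E → ℝ) (i : E) :
    Function.Periodic (fun t => cellwise Δ L t i) (K * Δ) := by
  intro t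
  have := cell_add hΔ t K
  simp only [Int.cast_natCast] at this
  simp [cellwise, this]

omit [Fintype E] in
theorem integral_cellwise [NeZero K] (hΔ : 0 < Δ) (L : ZMod K → E → ℝ) (i : E) :
    ∫ t in (0 : ℝ)..K * Δ, cellwise Δ L t i = Δ * ∑ k, L k i := by
  have h := intervalIntegral.sum_integral_adjacent_intervals (a := fun n : ℕ => n * Δ) (n := K)
    (μ := volume) (f := fun t => cellwise Δ L t i)
    fun k _ => cellwise_intervalIntegrable L i _ _
  simp only [Nat.cast_zero, zero_mul] at h
  rw [← h, ZMod.sum_univ_eq_sum_range fun k => L k i, Finset.mul_sum]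
  refine Finset.sum_congr rfl fun n _ => ?_
  have hle : (n : ℝ) * Δ ≤ ((n + 1 : ℕ) : ℝ) * Δ := by
    push_cast
    linarith
  have : ∫ t in (n : ℝ) * Δ..((n + 1 : ℕ) : ℝ) * Δ, cellwise Δ L t i =
      ∫ t in (n : ℝ) * Δ..((n + 1 : ℕ) : ℝ) * Δ, L (n : ZMod K) i := by
    refine intervalIntegral.integral_congr_Ioo_of_le hle fun t ht => ?_
    have h1 := cell_eq hΔ n (s := t - n * Δ) (by linarith [ht.1]) (by
      have := ht.2
      push_cast at this
      linarith)
    simp only [Int.cast_natCast, add_sub_cancel] at h1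
    simp [cellwise, h1]
  rw [this, intervalIntegral.integral_const, smul_eq_mul]
  push_cast
  ring

omit [Fintype E] in
theorem eq_cellwise [NeZero K] (hΔ : 0 < Δ) {f : ℝ → E → ℝ}
    (hper : ∀ t, 0 ≤ t → ∀ i, f (t + K * Δ) i = f t i)
    (hconst : ∀ i, ∀ k : ℕ, ∀ u v : ℝ, u ∈ Set.Ico ((k : ℝ) * Δ) ((k + 1 : ℝ) * Δ) →
      v ∈ Set.Ico ((k : ℝ) * Δ) ((k + 1 : ℝ) * Δ) → f u i = f v i) (t : ℝ) (ht : 0 ≤ t) (i : E) :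
    f t i = cellwise Δ (fun (k : ZMod K) i => f (k.val * Δ) i) t i := by
  obtain ⟨n, hn⟩ := Int.eq_ofNat_of_zero_le (Int.floor_nonneg.2 (div_nonneg ht hΔ.le))
  have hcell : cell Δ t = (n : ℤ) := hn
  have h0 := phase_nonneg hΔ t
  have h1 := phase_lt hΔ t
  have h2 := cell_add_phase (Δ := Δ) t
  rw [hcell, Int.cast_natCast] at h2
  rw [hconst i n t (n * Δ) ⟨by linarith, by linarith⟩ ⟨le_rfl, by linarith⟩]
  have hmul : ∀ q r : ℕ, f (((r + K * q : ℕ) : ℝ) * Δ) i = f (r * Δ) i := by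
    intro q r
    induction q with
    | zero => simp
    | succ q ih =>
      rw [← ih, ← hper (((r + K * q : ℕ) : ℝ) * Δ) (by positivity)]
      push_cast
      ring_nf
  have h3 := hmul (n / K) (n % K)
  rw [Nat.mod_add_div] at h3
  simp [cellwise, hcell, ZMod.val_natCast, h3]

end CellwiseData

/-- Existence, uniqueness and global attractivity of a `T`-periodic solution of the
traffic flow model, under the connectivity assumption, `T`-periodic locally piecewise
constant inflows and capacities, the stability condition, and commensurability of `T`,
the travel times, and the discontinuity points of `λ` and `c`. -/
theorem traffic_flow_periodic_orbit [Fintype E] [Nonempty E]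
    (R δ : E → E → ℝ) (lam c : ℝ → E → ℝ) (T : ℝ)
    (hT : 0 < T) (hRnn : ∀ j i, 0 ≤ R j i) (hδnn : ∀ j i, 0 ≤ δ j i)
    (hconn : ConnAssumption R)
    (hlam_nn : ∀ t, 0 ≤ t → ∀ i, 0 ≤ lam t i)
    (hc_nn : ∀ t, 0 ≤ t → ∀ i, 0 ≤ c t i)
    (hlam_pwc : ∀ i, LocPwcOn (fun t => lam t i) (Set.Ici 0))
    (hc_pwc : ∀ i, LocPwcOn (fun t => c t i) (Set.Ici 0))
    (hlam_per : ∀ t, 0 ≤ t → ∀ i, lam (t + T) i = lam t i)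
    (hc_per : ∀ t, 0 ≤ t → ∀ i, c (t + T) i = c t i)
    (hstab : Stability T R lam c)
    (hcomm : ∃ Δ : ℝ, 0 < Δ ∧ (∃ m : ℕ, T = m * Δ) ∧
      (∀ j i, ∃ m : ℕ, δ j i = m * Δ) ∧
      (∀ i, ∀ k : ℕ, ∀ u v : ℝ,
        u ∈ Set.Ico ((k : ℝ) * Δ) ((k + 1 : ℝ) * Δ) →
        v ∈ Set.Ico ((k : ℝ) * Δ) ((k + 1 : ℝ) * Δ) →
        lam u i = lam v i ∧ c u i = c v i)) :
    ∃ xs zs : ℝ → E → ℝ, IsSolution R δ lam c xs zs ∧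
      (∀ i, PwcOn (fun t => zs t i) (Set.Ico (-(dbar R δ)) 0)) ∧
      (∀ t, 0 ≤ t → ∀ i, xs (t + T) i = xs t i) ∧
      (∀ t, -(dbar R δ) ≤ t → ∀ i, zs (t + T) i = zs t i) ∧
      (∀ x' z' : ℝ → E → ℝ, IsSolution R δ lam c x' z' →
        (∀ t, 0 ≤ t → ∀ i, x' (t + T) i = x' t i) →
        (∀ t, -(dbar R δ) ≤ t → ∀ i, z' (t + T) i = z' t i) →
        ∀ t, 0 ≤ t → ∀ i, x' t i = xs t i ∧ z' t i = zs t i) ∧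
      (∀ x z : ℝ → E → ℝ, IsSolution R δ lam c x z →
        (∀ i, PwcOn (fun t => z t i) (Set.Ico (-(dbar R δ)) 0)) →
        Filter.Tendsto
          (fun t => (∑ i, |x t i - xs t i|) +
            ∑ i, ∑ j, R j i * ∫ s in (t - δ j i)..t, |z s j - zs s j|)
          Filter.atTop (nhds 0)) := by
  obtain ⟨Δ, hΔ, ⟨K, rfl⟩, hδm, hconst⟩ := hcomm
  choose m hm using hδm
  obtain rfl : δ = fun j i => m j i * Δ := funext fun j => funext fun i => hm j i
  have hK : K ≠ 0 := by
    rintro rfl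
    simp at hT
  have : NeZero K := ⟨hK⟩
  obtain ⟨p, hp⟩ := hconn.exists_isWeight hRnn
  set L : ZMod K → E → ℝ := fun k i => lam (k.val * Δ) i with hL
  set C : ZMod K → E → ℝ := fun k i => c (k.val * Δ) i with hC
  have hlamL : ∀ t, 0 ≤ t → ∀ i, lam t i = cellwise Δ L t i :=
    eq_cellwise hΔ hlam_per fun i k u v hu hv => (hconst i k u v hu hv).1
  have hcC : ∀ t, 0 ≤ t → ∀ i, c t i = cellwise Δ C t i :=
    eq_cellwise hΔ hc_per fun i k u v hu hv => (hconst i k u v hu hv).2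
  have hL0 : ∀ k i, 0 ≤ L k i := fun k i => hlam_nn _ (by positivity) i
  have hC0 : ∀ k i, 0 ≤ C k i := fun k i => hc_nn _ (by positivity) i
  have hintL : ∀ i, ∫ s in (0 : ℝ)..K * Δ, lam s i = ∫ s in (0 : ℝ)..K * Δ, cellwise Δ L s i :=
    fun i => intervalIntegral.integral_congr fun s hs =>
      hlamL s (by rw [Set.uIcc_of_le hT.le] at hs; exact hs.1) i
  have hintC : ∀ i, ∫ s in (0 : ℝ)..K * Δ, c s i = ∫ s in (0 : ℝ)..K * Δ, cellwise Δ C s i :=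
    fun i => intervalIntegral.integral_congr fun s hs =>
      hcC s (by rw [Set.uIcc_of_le hT.le] at hs; exact hs.1) i
  have hstab' : ∀ i, (∫ s in (0 : ℝ)..K * Δ, cellwise Δ L s i) +
      ∑ j, R j i * (∫ s in (0 : ℝ)..K * Δ, cellwise Δ C s j) <
        ∫ s in (0 : ℝ)..K * Δ, cellwise Δ C s i := by
    intro i
    have h := hstab i
    simp only [hintL, hintC, mul_left_comm (R _ _), ← Finset.mul_sum, ← mul_sub] at h
    have := lt_of_mul_lt_mul_left h (by positivity)
    linarith
  have hnet : ∀ i, ∑ k, (L k i + ∑ j, R j i * C k j - C k i) < 0 := by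
    intro i
    have h := hstab' i
    simp only [integral_cellwise hΔ, mul_left_comm (R _ _), ← Finset.mul_sum, ← mul_add] at h
    have h1 := lt_of_mul_lt_mul_left h hΔ.le
    simp only [Finset.mul_sum] at h1
    rw [Finset.sum_comm] at h1
    rw [Finset.sum_sub_distrib, Finset.sum_add_distrib]
    linarith
  obtain ⟨xs, zs, hs, hpwc, hxsT, hzsT⟩ := exists_periodic_solution (m := m) hRnn hp hΔ hL0 hC0 hnet
  have hlamI := fun i a b => cellwise_intervalIntegrable (Δ := Δ) L i a b
  have hcI := fun i a b => cellwise_intervalIntegrable (Δ := Δ) C i a b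
  have hempty : ∀ {x z : ℝ → E → ℝ},
      IsSolution R (fun j i => m j i * Δ) (cellwise Δ L) (cellwise Δ C) x z →
      ∀ i a, ∃ t, 0 ≤ t ∧ a ≤ t ∧ x t i = 0 := fun h =>
    h.exists_queue_eq_zero hRnn hT hlamI hcI (cellwise_periodic hΔ L) (cellwise_periodic hΔ C)
      hstab'
  have hqueue : ∀ {x z : ℝ → E → ℝ},
      IsSolution R (fun j i => m j i * Δ) (cellwise Δ L) (cellwise Δ C) x z →
      ∀ i, Filter.Tendsto (fun t => |x t i - xs t i|) Filter.atTop (nhds 0) := fun h i =>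
    h.tendsto_queue_sub hs hRnn hδnn hp hlamI i
      (h.exists_queue_eq hs hRnn hlamI i (hempty h i) (hempty hs i))
  refine ⟨xs, zs, hs.congr (fun t ht i => (hlamL t ht i).symm) fun t ht i => (hcC t ht i).symm,
    fun i => hpwc i _ _, fun t _ => hxsT t, fun t _ => hzsT t, ?_, ?_⟩
  · intro x' z' h hxT hzT
    replace h := h.congr hlamL hcC
    have hx : ∀ t, 0 ≤ t → ∀ i, x' t i = xs t i := fun t ht i => sub_eq_zero.1 <|
      eq_of_periodic_of_tendsto (f := fun t => x' t i - xs t i) hT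
        (fun t ht => by rw [hxT t ht, hxsT t]) (hqueue h i) ht
    refine fun t ht i => ⟨hx t ht i, h.outflow_eq_of_periodic hs hRnn hp hT (fun i =>
      ⟨∑ k, C k i, fun t => ?_⟩) hx hzT (fun t _ => hzsT t) ht i⟩
    exact Finset.single_le_sum (f := fun k => C k i) (fun k _ => hC0 k i) (Finset.mem_univ _)
  · intro x z h _
    replace h := h.congr hlamL hcC
    have h1 : Filter.Tendsto (fun t => ∑ i, |x t i - xs t i|) Filter.atTop (nhds 0) := by
      simpa using tendsto_finsetSum Finset.univ fun i _ => hqueue h i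
    have h2 : Filter.Tendsto (fun t => ∑ i, ∑ j, R j i *
        ∫ s in (t - m j i * Δ)..t, |z s j - zs s j|) Filter.atTop (nhds 0) := by
      have := tendsto_finsetSum Finset.univ fun i _ => tendsto_finsetSum Finset.univ fun j _ =>
        (h.tendsto_integral_gap hs hRnn hδnn hp hlamI j (m j i * Δ) (hδnn j i)).const_mul (R j i)
      simpa [gap] using this
    simpa using h1.add h2
end

section
/- Let x be a queue trajectory for (y, c). If 0 ≤ α − ε < α for some ε > 0 and y(t) > c(t) for almost every t ∈ [α − ε, α], then x(α) > 0. -/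
open MeasureTheory

/-- `f` is locally piecewise constant on `[0, ∞)`: piecewise constant on every compact
subinterval. -/
def LocPwc (f : ℝ → ℝ) : Prop :=
  ∀ a b : ℝ, PwcOn f (Set.Ici 0 ∩ Set.Icc a b)

/-- The net rate of change of the queue: `y − c` when the queue is positive, and
`max (y − c) 0` when the queue is empty. -/
noncomputable def qrate (y c x : ℝ → ℝ) (r : ℝ) : ℝ :=
  if 0 < x r then y r - c r else max (y r - c r) 0

/-- `x` is a queue trajectory for inflow `y` and capacity `c`: it is nonnegative on
`[0, ∞)` and satisfies `x t = x 0 + ∫_0^t qrate` for every `t ≥ 0`. -/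
def QueueTraj (y c x : ℝ → ℝ) : Prop :=
  (∀ t, 0 ≤ t → 0 ≤ x t) ∧
  ∀ t, 0 ≤ t → x t = x 0 + ∫ r in (0:ℝ)..t, qrate y c x r

/-- The outflow of the queue trajectory `x` for `(y, c)`: the capacity when the queue is
positive, and `min y c` when the queue is empty. -/
noncomputable def outflow (y c x : ℝ → ℝ) (t : ℝ) : ℝ :=
  if 0 < x t then c t else min (y t) (c t)

/-- `α` is a transition point of the queue trajectory `x`: `x α = 0` and `x` is strictly
positive on some interval `(α, α + ε]`. -/
def TransitionPt (x : ℝ → ℝ) (α : ℝ) : Prop :=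
  0 ≤ α ∧ x α = 0 ∧ ∃ ε > 0, ∀ t ∈ Set.Ioc α (α + ε), 0 < x t

/-- The net rate of change is dominated by `|y - c|`. -/
lemma abs_qrate_le (y c x : ℝ → ℝ) (r : ℝ) : |qrate y c x r| ≤ |y r - c r| := by
  unfold qrate
  split_ifs
  · exact le_rfl
  · rw [abs_of_nonneg (le_max_right _ _)]
    exact max_le (le_abs_self _) (abs_nonneg _)

/-- The net rate of change is at least `y - c`. -/
lemma sub_le_qrate (y c x : ℝ → ℝ) (r : ℝ) : y r - c r ≤ qrate y c x r := by
  unfold qrate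
  split_ifs
  · exact le_rfl
  · exact le_max_left _ _

/-- If `x` is given on `[0, ∞)` by a primitive of an arbitrary function `f` (the integral being
zero wherever `f` fails to be integrable), then `x` is measurable there. -/
lemma aemeasurable_of_eq_primitive {f x : ℝ → ℝ}
    (h : ∀ t, 0 ≤ t → x t = x 0 + ∫ r in (0:ℝ)..t, f r) :
    AEMeasurable x (volume.restrict (Set.Ici 0)) := by
  classical
  set S : Set ℝ := {t | 0 ≤ t ∧ IntervalIntegrable f volume 0 t} with hS
  have hmono : ∀ t ∈ S, Set.Icc 0 t ⊆ S := fun t ht u hu =>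
    ⟨hu.1, ht.2.mono_set (by
      rw [Set.uIcc_of_le hu.1, Set.uIcc_of_le ht.1]
      exact Set.Icc_subset_Icc_right hu.2)⟩
  have hSmeas : MeasurableSet S := by
    have : S.OrdConnected := ⟨fun a ha b hb u hu => hmono b hb ⟨ha.1.trans hu.1, hu.2⟩⟩
    exact this.measurableSet
  have hcontIcc : ∀ t ∈ S, ContinuousOn x (Set.Icc 0 t) := by
    intro t ht
    have h1 := intervalIntegral.continuousOn_primitive_interval' ht.2 Set.left_mem_uIcc
    rw [Set.uIcc_of_le ht.1] at h1
    exact (continuousOn_const.add h1).congr fun u hu => h u hu.1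
  have hcont : ContinuousOn x S := by
    intro t ht
    by_cases hmax : ∃ u ∈ S, t < u
    · obtain ⟨u, hu, htu⟩ := hmax
      refine (hcontIcc u hu t ⟨ht.1, htu.le⟩).mono_of_mem_nhdsWithin ?_
      filter_upwards [self_mem_nhdsWithin, nhdsWithin_le_nhds (Iio_mem_nhds htu)] with v hv hvu
      exact ⟨hv.1, le_of_lt hvu⟩
    · push Not at hmax
      exact (hcontIcc t ht t ⟨ht.1, le_rfl⟩).mono fun v hv => ⟨hv.1, hmax v hv⟩
  have h1 : AEMeasurable x (volume.restrict S) := hcont.aemeasurable hSmeas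
  have h2 : AEMeasurable x (volume.restrict (Set.Ici 0 \ S)) := by
    refine (aemeasurable_const (b := x 0)).congr ?_
    filter_upwards [ae_restrict_mem (measurableSet_Ici.diff hSmeas)] with t ht
    rw [h t ht.1, intervalIntegral.integral_undef fun hi => ht.2 ⟨ht.1, hi⟩, add_zero]
  have h3 := aemeasurable_union_iff.2 ⟨h1, h2⟩
  exact h3.mono_measure (Measure.restrict_mono (by simp) le_rfl)

/-- Along a queue trajectory the net rate of change is integrable on compact intervals. -/
lemma QueueTraj.intervalIntegrable_qrate {y c x : ℝ → ℝ} (hx : QueueTraj y c x)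
    (hy : LocallyIntegrableOn y (Set.Ici 0)) (hc : LocallyIntegrableOn c (Set.Ici 0))
    {t : ℝ} (ht : 0 ≤ t) : IntervalIntegrable (qrate y c x) volume 0 t := by
  have hsub : Set.Icc 0 t ⊆ Set.Ici (0:ℝ) := Set.Icc_subset_Ici_self
  have hd : IntegrableOn (fun r => y r - c r) (Set.Icc 0 t) :=
    (hy.integrableOn_compact_subset hsub isCompact_Icc).sub
      (hc.integrableOn_compact_subset hsub isCompact_Icc)
  have hxm : AEMeasurable x (volume.restrict (Set.Icc 0 t)) :=
    (aemeasurable_of_eq_primitive hx.2).mono_measure (Measure.restrict_mono hsub le_rfl)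
  have hqm : AEMeasurable (qrate y c x) (volume.restrict (Set.Icc 0 t)) := by
    have hdm := hd.aemeasurable
    have hp : Measurable fun p : ℝ × ℝ => if 0 < p.1 then p.2 else max p.2 0 :=
      Measurable.ite (measurableSet_lt measurable_const measurable_fst) measurable_snd
        (measurable_snd.max measurable_const)
    exact hp.comp_aemeasurable (hxm.prodMk hdm)
  rw [intervalIntegrable_iff_integrableOn_Icc_of_le ht]
  exact Integrable.mono hd hqm.aestronglyMeasurable
    (Filter.Eventually.of_forall (abs_qrate_le y c x))

/-- If the inflow strictly exceeds the capacity almost everywhere on `[α − ε, α]`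
with `0 ≤ α − ε < α`, then the queue is strictly positive at time `α`. -/
theorem queue_positive_after_excess (y c x : ℝ → ℝ) (α ε : ℝ)
    (hy_nn : ∀ t, 0 ≤ t → 0 ≤ y t) (hc_nn : ∀ t, 0 ≤ t → 0 ≤ c t)
    (hy_int : LocallyIntegrableOn y (Set.Ici 0))
    (hc_int : LocallyIntegrableOn c (Set.Ici 0))
    (hx : QueueTraj y c x)
    (hε : 0 < ε) (hαε : 0 ≤ α - ε)
    (hgt : ∀ᵐ t ∂volume, t ∈ Set.Icc (α - ε) α → c t < y t) :
    0 < x α := by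
  have hα : 0 ≤ α := by linarith
  have hle : α - ε ≤ α := by linarith
  have i1 := hx.intervalIntegrable_qrate hy_int hc_int hαε
  have i2 := hx.intervalIntegrable_qrate hy_int hc_int hα
  have i3 : IntervalIntegrable (qrate y c x) volume (α - ε) α := i1.symm.trans i2
  have hpos : ∀ᵐ t ∂volume.restrict (Set.Ioc (α - ε) α), 0 < qrate y c x t := by
    rw [ae_restrict_iff' measurableSet_Ioc]
    filter_upwards [hgt] with t ht hmem
    linarith [ht (Set.Ioc_subset_Icc_self hmem), sub_le_qrate y c x t]
  have hint : 0 < ∫ r in (α - ε)..α, qrate y c x r := by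
    rw [intervalIntegral.integral_of_le hle]
    have hnn := hpos.mono fun t ht => ht.le
    refine lt_of_le_of_ne (integral_nonneg_of_ae hnn) fun h0 => ?_
    have hz := (integral_eq_zero_iff_of_nonneg_ae hnn i3.1).1 h0.symm
    have hF : ∀ᵐ t ∂volume.restrict (Set.Ioc (α - ε) α), False := by
      filter_upwards [hpos, hz] with t h1 h2
      exact h1.ne' h2
    rw [Filter.eventually_false_iff_eq_bot, ae_eq_bot, Measure.restrict_eq_zero,
      Real.volume_Ioc, ENNReal.ofReal_eq_zero] at hF
    linarith
  have hadd := intervalIntegral.integral_add_adjacent_intervals i1 i3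
  have e1 := hx.2 α hα
  have e2 := hx.2 (α - ε) hαε
  have e3 := hx.1 (α - ε) hαε
  linarith
end

section
/- Let y, y′, c : [0,∞) → [0,∞) be locally piecewise constant and T-periodic (for some T > 0) with y(t) ≤ y′(t) for all t ≥ 0. Let x* be a T-periodic queue trajectory for (y, c) and x*′ a T-periodic queue trajectory for (y′, c), and assume both are globally attractive: every queue trajectory x̂ for (y, c) satisfies |x̂(t) − x*(t)| → 0 as t → ∞, and every queue trajectory x̂′ for (y′, c) satisfies |x̂′(t) − x*′(t)| → 0 as t → ∞. Then x*(t) ≤ x*′(t) for all t ≥ 0, and the corresponding outflows satisfy z*(t) ≤ z*′(t) for all t ≥ 0. -/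
open MeasureTheory

/-- A locally piecewise constant function is integrable on compact intervals. -/
theorem LocPwc.integrableOn {f : ℝ → ℝ} (hf : LocPwc f) (b : ℝ) :
    IntegrableOn f (Set.Icc 0 b) := by
  obtain ⟨D, hD⟩ := hf 0 b
  let σ : ℝ → Finset ℝ := fun u => D.filter (· ≤ u)
  have hσ : Monotone σ := fun u v huv d hd => by
    simp only [σ, Finset.mem_filter] at hd ⊢
    exact ⟨hd.1, hd.2.trans huv⟩
  have hcover : Set.Icc 0 b = ⋃ S ∈ D.powerset, Set.Icc 0 b ∩ σ ⁻¹' {S} := by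
    ext u
    simp [σ]
  rw [hcover, integrableOn_finset_iUnion]
  intro S _
  have hmeas : MeasurableSet (Set.Icc 0 b ∩ σ ⁻¹' {S}) :=
    measurableSet_Icc.inter (Set.ordConnected_singleton.preimage_mono hσ).measurableSet
  have hconst : ∀ u ∈ Set.Icc 0 b ∩ σ ⁻¹' {S}, ∀ v ∈ Set.Icc 0 b ∩ σ ⁻¹' {S},
      u ≤ v → f u = f v := by
    rintro u ⟨hu, hu'⟩ v ⟨hv, hv'⟩ huv
    refine hD u ⟨hu.1, hu⟩ v ⟨hv.1, hv⟩ huv fun d hd hduv => ?_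
    have hmem : d ∈ σ v := by simp [σ, hd, hduv.2]
    rw [Set.mem_preimage, Set.mem_singleton_iff] at hu' hv'
    rw [hv', ← hu'] at hmem
    exact absurd (Finset.mem_filter.1 hmem).2 (not_le.2 hduv.1)
  rcases (Set.Icc 0 b ∩ σ ⁻¹' {S}).eq_empty_or_nonempty with h | ⟨u, hu⟩
  · simp [h]
  · have hfin : volume (Set.Icc 0 b ∩ σ ⁻¹' {S}) ≠ ⊤ :=
      ((measure_mono Set.inter_subset_left).trans_lt measure_Icc_lt_top).ne
    refine (integrableOn_const (C := f u) hfin).congr_fun (fun v hv => ?_) hmeas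
    rcases le_total u v with h | h
    · exact hconst u hu v hv h
    · exact (hconst v hv u hu h).symm

/-- The primitive of an arbitrary function is measurable, with the integral of a
non-integrable function being zero. -/
theorem measurable_intervalIntegral_right (g : ℝ → ℝ) (a : ℝ) :
    Measurable fun t => ∫ r in a..t, g r := by
  classical
  let A : Set ℝ := {s | IntervalIntegrable g volume a s}
  have hA : A.OrdConnected := by
    refine Set.ordConnected_iff.2 fun u hu v hv _ w hw => ?_
    rcases le_total a w with h | h
    · exact IntervalIntegrable.mono_set hv (Set.uIcc_subset_uIcc Set.left_mem_uIcc
        (Set.mem_uIcc.2 (Or.inl ⟨h, hw.2⟩)))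
    · exact IntervalIntegrable.mono_set hu (Set.uIcc_subset_uIcc Set.left_mem_uIcc
        (Set.mem_uIcc.2 (Or.inr ⟨hw.1, h⟩)))
  have hcont : ContinuousOn (fun t => ∫ r in a..t, g r) A := by
    intro s hs
    obtain ⟨b₂, hb₂, hsb₂⟩ : ∃ b ∈ A, Set.Iic b ∈ nhdsWithin s A := by
      by_cases h : ∃ v ∈ A, s < v
      · obtain ⟨v, hv, hsv⟩ := h
        exact ⟨v, hv, mem_nhdsWithin_of_mem_nhds (Iic_mem_nhds hsv)⟩
      · push Not at h
        exact ⟨s, hs, Filter.mem_of_superset self_mem_nhdsWithin h⟩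
    obtain ⟨b₁, hb₁, hsb₁⟩ : ∃ b ∈ A, Set.Ici b ∈ nhdsWithin s A := by
      by_cases h : ∃ v ∈ A, v < s
      · obtain ⟨v, hv, hsv⟩ := h
        exact ⟨v, hv, mem_nhdsWithin_of_mem_nhds (Ici_mem_nhds hsv)⟩
      · push Not at h
        exact ⟨s, hs, Filter.mem_of_superset self_mem_nhdsWithin h⟩
    have haA : a ∈ A := IntervalIntegrable.refl
    have hmin : min a b₁ ∈ A := by rcases min_choice a b₁ with h | h <;> rw [h] <;> assumption
    have hmax : max a b₂ ∈ A := by rcases max_choice a b₂ with h | h <;> rw [h] <;> assumption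
    exact (intervalIntegral.continuousWithinAt_primitive (measure_singleton s)
      (IntervalIntegrable.trans (IntervalIntegrable.symm hmin) hmax)).mono_of_mem_nhdsWithin
        (Filter.inter_mem hsb₁ hsb₂)
  have hpw : (fun t => ∫ r in a..t, g r) = A.piecewise (fun t => ∫ r in a..t, g r) 0 := by
    funext t
    by_cases ht : t ∈ A
    · rw [Set.piecewise_eq_of_mem _ _ _ ht]
    · rw [Set.piecewise_eq_of_notMem _ _ _ ht]
      exact intervalIntegral.integral_undef ht
  rw [hpw]
  exact hcont.measurable_piecewise continuousOn_const hA.measurableSet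

namespace QueueTraj

variable {y y' c x x' : ℝ → ℝ}

theorem integrableOn_qrate (hx : QueueTraj y c x) (hy : LocPwc y) (hc : LocPwc c) (b : ℝ) :
    IntegrableOn (qrate y c x) (Set.Icc 0 b) := by
  classical
  have hmeas : MeasurableSet {t | 0 < x 0 + ∫ r in (0 : ℝ)..t, qrate y c x r} :=
    measurableSet_lt measurable_const
      ((measurable_intervalIntegral_right _ 0).const_add (x 0))
  have hdiff : IntegrableOn (fun r => y r - c r) (Set.Icc 0 b) :=
    (hy.integrableOn b).sub (hc.integrableOn b)
  have hpos : IntegrableOn (fun r => max (y r - c r) 0) (Set.Icc 0 b) := Integrable.pos_part hdiff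
  refine IntegrableOn.congr_fun (Integrable.piecewise hmeas hdiff.integrableOn hpos.integrableOn)
    (fun t ht => ?_) measurableSet_Icc
  simp only [Set.piecewise, Set.mem_ofPred_eq]
  rw [← hx.2 t ht.1, qrate]

theorem intervalIntegrable_qrate_s17 (hx : QueueTraj y c x) (hy : LocPwc y) (hc : LocPwc c)
    {s t : ℝ} (hs : 0 ≤ s) (ht : 0 ≤ t) : IntervalIntegrable (qrate y c x) volume s t :=
  ((hx.integrableOn_qrate hy hc (max s t)).mono_set
    (Set.Icc_subset_Icc (le_min hs ht) le_rfl)).intervalIntegrable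

theorem sub_eq_integral (hx : QueueTraj y c x) (hy : LocPwc y) (hc : LocPwc c)
    {s t : ℝ} (hs : 0 ≤ s) (ht : 0 ≤ t) : x t - x s = ∫ r in s..t, qrate y c x r := by
  rw [hx.2 t ht, hx.2 s hs, ← intervalIntegral.integral_interval_sub_left
    (hx.intervalIntegrable_qrate_s17 hy hc le_rfl ht) (hx.intervalIntegrable_qrate_s17 hy hc le_rfl hs)]
  ring

theorem continuousOn (hx : QueueTraj y c x) (hy : LocPwc y) (hc : LocPwc c) (b : ℝ) :
    ContinuousOn x (Set.Icc 0 b) := by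
  rcases lt_or_ge b 0 with hb | hb
  · simp [Set.Icc_eq_empty_of_lt hb]
  have h := intervalIntegral.continuousOn_primitive_interval (a := 0) (b := b)
    (f := qrate y c x) (μ := volume)
    (by rw [Set.uIcc_of_le hb]; exact hx.integrableOn_qrate hy hc b)
  rw [Set.uIcc_of_le hb] at h
  exact (continuousOn_const.add h).congr fun t ht => hx.2 t ht.1

/-- A queue with the larger inflow which is ahead at time `s` stays ahead. -/
theorem le_of_le (hx : QueueTraj y c x) (hx' : QueueTraj y' c x') (hy : LocPwc y)
    (hy' : LocPwc y') (hc : LocPwc c) (hle : ∀ t, 0 ≤ t → y t ≤ y' t)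
    {s t : ℝ} (hs : 0 ≤ s) (hst : s ≤ t) (h : x s ≤ x' s) : x t ≤ x' t := by
  by_contra! hlt
  have hsub : Set.Icc s t ⊆ Set.Icc 0 t := Set.Icc_subset_Icc_left hs
  let K : Set ℝ := {r ∈ Set.Icc s t | x r ≤ x' r}
  have hK : IsCompact K := isCompact_Icc.of_isClosed_subset
    (isClosed_Icc.isClosed_le ((hx.continuousOn hy hc t).mono hsub)
      ((hx'.continuousOn hy' hc t).mono hsub)) fun _ hr => hr.1
  obtain ⟨u, ⟨hu, hxu⟩, humax⟩ := hK.exists_isGreatest ⟨s, ⟨le_rfl, hst⟩, h⟩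
  have hu0 : 0 ≤ u := hs.trans hu.1
  have ht0 : 0 ≤ t := hs.trans hst
  have hmono : ∫ r in u..t, qrate y c x r ≤ ∫ r in u..t, qrate y' c x' r := by
    refine intervalIntegral.integral_mono_on_of_le_Ioo hu.2
      (hx.intervalIntegrable_qrate_s17 hy hc hu0 ht0)
      (hx'.intervalIntegrable_qrate_s17 hy' hc hu0 ht0) fun r hr => ?_
    have hr0 : 0 ≤ r := hu0.trans hr.1.le
    have hlt' : x' r < x r := by
      by_contra! hle'
      exact hr.1.not_ge (humax ⟨⟨hu.1.trans hr.1.le, hr.2.le⟩, hle'⟩)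
    have hyy := hle r hr0
    rw [qrate, if_pos ((hx'.1 r hr0).trans_lt hlt'), qrate]
    split_ifs
    · linarith
    · exact le_max_of_le_left (by linarith)
  rw [← hx.sub_eq_integral hy hc hu0 ht0, ← hx'.sub_eq_integral hy' hc hu0 ht0] at hmono
  linarith

/-- Adding a constant to a queue that never empties gives another queue trajectory. -/
theorem add_const (hx : QueueTraj y c x) (hpos : ∀ t, 0 ≤ t → 0 < x t) {d : ℝ} (hd : 0 ≤ d) :
    QueueTraj y c fun t => x t + d := by
  refine ⟨fun t ht => add_nonneg (hx.1 t ht) hd, fun t ht => ?_⟩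
  have hcongr : ∫ r in (0 : ℝ)..t, qrate y c (fun t => x t + d) r =
      ∫ r in (0 : ℝ)..t, qrate y c x r := by
    refine intervalIntegral.integral_congr fun r hr => ?_
    rw [Set.uIcc_of_le ht] at hr
    have h := hpos r hr.1
    simp only [qrate, if_pos h, if_pos (add_pos_of_pos_of_nonneg h hd)]
  beta_reduce
  rw [hcongr, hx.2 t ht]
  ring

/-- A globally attractive queue trajectory empties at some time. -/
theorem exists_eq_zero (hx : QueueTraj y c x)
    (hattr : ∀ xh : ℝ → ℝ, QueueTraj y c xh →
      Filter.Tendsto (fun t => |xh t - x t|) Filter.atTop (nhds 0)) :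
    ∃ s, 0 ≤ s ∧ x s = 0 := by
  by_contra! h
  have hlim := hattr _ (hx.add_const (fun t ht => (hx.1 t ht).lt_of_ne (h t ht).symm) zero_le_one)
  simp only [add_sub_cancel_left, abs_one] at hlim
  exact one_ne_zero (tendsto_nhds_unique tendsto_const_nhds hlim)

end QueueTraj

theorem apply_add_nat_mul_period {f : ℝ → ℝ} {T : ℝ} (hT : 0 ≤ T)
    (hf : ∀ t, 0 ≤ t → f (t + T) = f t) (n : ℕ) {t : ℝ} (ht : 0 ≤ t) :
    f (t + n * T) = f t := by
  induction n with
  | zero => simp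
  | succ n ih =>
    rw [← ih, ← hf (t + n * T) (by positivity)]
    congr 1
    push_cast
    ring

/-- Monotonicity of the globally attractive periodic queue trajectories: if `y ≤ y′`
pointwise, the `T`-periodic globally attractive queue trajectories for `(y, c)` and
`(y′, c)` and their outflows are ordered for all `t ≥ 0`. -/
theorem periodic_queue_monotone (T : ℝ) (y y' c xs xs' : ℝ → ℝ)
    (hT : 0 < T)
    (hy_nn : ∀ t, 0 ≤ t → 0 ≤ y t) (hy'_nn : ∀ t, 0 ≤ t → 0 ≤ y' t)
    (hc_nn : ∀ t, 0 ≤ t → 0 ≤ c t)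
    (hy_pwc : LocPwc y) (hy'_pwc : LocPwc y') (hc_pwc : LocPwc c)
    (hy_per : ∀ t, 0 ≤ t → y (t + T) = y t)
    (hy'_per : ∀ t, 0 ≤ t → y' (t + T) = y' t)
    (hc_per : ∀ t, 0 ≤ t → c (t + T) = c t)
    (hle : ∀ t, 0 ≤ t → y t ≤ y' t)
    (hxs : QueueTraj y c xs) (hxs' : QueueTraj y' c xs')
    (hxs_per : ∀ t, 0 ≤ t → xs (t + T) = xs t)
    (hxs'_per : ∀ t, 0 ≤ t → xs' (t + T) = xs' t)
    (hxs_attr : ∀ xh : ℝ → ℝ, QueueTraj y c xh →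
      Filter.Tendsto (fun t => |xh t - xs t|) Filter.atTop (nhds 0))
    (hxs'_attr : ∀ xh : ℝ → ℝ, QueueTraj y' c xh →
      Filter.Tendsto (fun t => |xh t - xs' t|) Filter.atTop (nhds 0)) :
    ∀ t, 0 ≤ t → xs t ≤ xs' t ∧ outflow y c xs t ≤ outflow y' c xs' t := by
  intro t ht
  have hx : xs t ≤ xs' t := by
    obtain ⟨s, hs, hs0⟩ := hxs.exists_eq_zero hxs_attr
    obtain ⟨n, hn⟩ := exists_nat_ge (s / T)
    have hsn : s ≤ t + n * T := by linarith [(div_le_iff₀ hT).1 hn]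
    have h := hxs.le_of_le hxs' hy_pwc hy'_pwc hc_pwc hle hs hsn (hs0 ▸ hxs'.1 s hs)
    rwa [apply_add_nat_mul_period hT.le hxs_per n ht,
      apply_add_nat_mul_period hT.le hxs'_per n ht] at h
  refine ⟨hx, ?_⟩
  rw [outflow, outflow]
  split_ifs with h h'
  · exact le_rfl
  · exact absurd (h.trans_le hx) h'
  · exact min_le_right _ _
  · exact min_le_min_right _ (hle t ht)
end
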